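/- arXiv:1512.02279 — 2 statements merged into one kernel-verified Lean document; each statement's English description precedes it below -/
import Mathlib

section
/- If 0 ≤ r ≤ n−2, then the ideal I_r(PB_n) is idempotent-generated, and rank(I_r(PB_n)) = idrank(I_r(PB_n)) = C(n,r−1)·(n−r)!! + C(n,r)·a(n−r), where a(0) = a(1) = 1 and a(m) = a(m−1) + (m−1)·a(m−2) for m ≥ 2. -/
/-!
Partial Brauer diagrams on `n` points are formalized as set partitions
(equivalence relations, i.e. `Setoid`s) of the vertex set
`{1,…,n} ∪ {1',…,n'}`, encoded as `Fin n ⊕ Fin n`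
(`Sum.inl i` is the upper vertex `i`, `Sum.inr i` is the lower vertex `i'`),
all of whose blocks have size at most 2.  The product of two diagrams is
defined via connectivity (paths) in the product graph, and the involution `*`
by interchanging the two rows of vertices.
-/

noncomputable section

open scoped Classical

/-- Vertices of a diagram on `n` points. -/
abbrev PBV (n : ℕ) := Fin n ⊕ Fin n

/-- A "diagram candidate": an arbitrary set partition of the vertices. -/
abbrev Dgm (n : ℕ) := Setoid (PBV n)

/-- The equivalence relation ("joined by a path") generated by a relation. -/
inductive RGen {V : Type*} (r : V → V → Prop) : V → V → Prop
  | rel {x y : V} : r x y → RGen r x y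
  | refl (x : V) : RGen r x x
  | symm {x y : V} : RGen r x y → RGen r y x
  | trans {x y z : V} : RGen r x y → RGen r y z → RGen r x z

namespace Dgm

variable {n : ℕ}

/-- Vertices of the product graph: top, middle and bottom rows. -/
abbrev V3 (n : ℕ) := Fin n ⊕ (Fin n ⊕ Fin n)

/-- The first factor occupies the top and middle rows of the product graph. -/
def topMid : PBV n → V3 n
  | Sum.inl i => Sum.inl i
  | Sum.inr i => Sum.inr (Sum.inl i)

/-- The second factor occupies the middle and bottom rows of the product graph. -/
def midBot : PBV n → V3 n
  | Sum.inl i => Sum.inr (Sum.inl i)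
  | Sum.inr i => Sum.inr (Sum.inr i)

/-- The product diagram occupies the top and bottom rows of the product graph. -/
def topBot : PBV n → V3 n
  | Sum.inl i => Sum.inl i
  | Sum.inr i => Sum.inr (Sum.inr i)

/-- The edges of the product graph `Γ(α, β)`. -/
def prodEdges (α β : Dgm n) (x y : V3 n) : Prop :=
  (∃ a b : PBV n, α.r a b ∧ x = topMid a ∧ y = topMid b) ∨
  (∃ a b : PBV n, β.r a b ∧ x = midBot a ∧ y = midBot b)

/-- The product of two diagrams: two vertices lie in the same block of `α β`
iff they are joined by a path in the product graph `Γ(α, β)`. -/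
def pmul (α β : Dgm n) : Dgm n where
  r x y := RGen (prodEdges α β) (topBot x) (topBot y)
  iseqv := ⟨fun _ => RGen.refl _, fun h => h.symm, fun h₁ h₂ => h₁.trans h₂⟩

/-- Interchanging the upper and the lower vertices. -/
def swapUD : PBV n → PBV n
  | Sum.inl i => Sum.inr i
  | Sum.inr i => Sum.inl i

/-- The involution `α ↦ α*` (reflection in a horizontal axis). -/
def pstar (α : Dgm n) : Dgm n := Setoid.comap swapUD α

/-- All blocks of `α` have size at most 2. -/
def IsPB (α : Dgm n) : Prop :=
  ∀ x y z : PBV n, α.r x y → α.r x z → x = y ∨ x = z ∨ y = z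

/-- The partial Brauer monoid `PB_n` (as a set of diagrams). -/
def PBset (n : ℕ) : Set (Dgm n) := {α | IsPB α}

/-- The position of a vertex in the linear order `1 < 2 < ⋯ < n < n' < ⋯ < 1'`. -/
def vpos : PBV n → ℕ
  | Sum.inl i => (i : ℕ)
  | Sum.inr i => 2 * n - 1 - (i : ℕ)

/-- Planarity: no two blocks cross in the order `1 < ⋯ < n < n' < ⋯ < 1'`. -/
def IsPlanar (α : Dgm n) : Prop :=
  ∀ a b c d : PBV n, α.r a b → α.r c d →
    vpos a < vpos c → vpos c < vpos b → vpos b < vpos d → False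

/-- The Motzkin monoid `M_n` (as a set of diagrams). -/
def Mset (n : ℕ) : Set (Dgm n) := {α | IsPB α ∧ IsPlanar α}

/-- The domain of `α`: upper points lying in a transversal block. -/
def domSet (α : Dgm n) : Set (Fin n) := {i | ∃ j, α.r (Sum.inl i) (Sum.inr j)}

/-- The codomain of `α`: lower points lying in a transversal block. -/
def codomSet (α : Dgm n) : Set (Fin n) := {i | ∃ j, α.r (Sum.inr i) (Sum.inl j)}

/-- The rank of a diagram: the number of its transversal blocks (for a diagram
with blocks of size at most 2, each transversal block contains exactly one
upper point, so this is the size of the domain). -/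
def prank (α : Dgm n) : ℕ := (domSet α).ncard

/-- `α` is an idempotent. -/
def IsIdpt (α : Dgm n) : Prop := pmul α α = α

/-- `α` is a projection. -/
def IsProj (α : Dgm n) : Prop := pmul α α = α ∧ pstar α = α

/-- The D-class `D_r(PB_n)`. -/
def DPB (n r : ℕ) : Set (Dgm n) := {α | α ∈ PBset n ∧ prank α = r}

/-- The ideal `I_r(PB_n)`. -/
def IPB (n r : ℕ) : Set (Dgm n) := {α | α ∈ PBset n ∧ prank α ≤ r}

/-- The D-class `D_r(M_n)`. -/
def DM (n r : ℕ) : Set (Dgm n) := {α | α ∈ Mset n ∧ prank α = r}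

/-- The ideal `I_r(M_n)`. -/
def IM (n r : ℕ) : Set (Dgm n) := {α | α ∈ Mset n ∧ prank α ≤ r}

end Dgm

/-- Membership in the closure of a subset under a binary operation. -/
inductive MClo {γ : Type*} (m : γ → γ → γ) (X : Set γ) : γ → Prop
  | base {x : γ} : x ∈ X → MClo m X x
  | mul {x y : γ} : MClo m X x → MClo m X y → MClo m X (m x y)

/-- The subsemigroup `⟨X⟩` generated by the subset `X`. -/
def genSet {γ : Type*} (m : γ → γ → γ) (X : Set γ) : Set γ := {x | MClo m X x}

/-- The rank of `T`: the least size of a generating set. -/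
noncomputable def rnk {γ : Type*} (m : γ → γ → γ) (T : Set γ) : ℕ :=
  sInf {k | ∃ X : Finset γ, X.card = k ∧ genSet m ↑X = T}

/-- The idempotent rank of `T`: the least size of a generating set consisting
of idempotents. -/
noncomputable def idrnk {γ : Type*} (m : γ → γ → γ) (T : Set γ) : ℕ :=
  sInf {k | ∃ X : Finset γ, X.card = k ∧ (∀ x ∈ X, m x x = x) ∧ genSet m ↑X = T}

/-- `T` is idempotent-generated. -/
def IdptGen {γ : Type*} (m : γ → γ → γ) (T : Set γ) : Prop :=
  genSet m {x ∈ T | m x x = x} = T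

open Dgm
/-- `a(m)`: `a(0) = a(1) = 1` and `a(m) = a(m-1) + (m-1)·a(m-2)`. -/
def aSeq : ℕ → ℕ
  | 0 => 1
  | 1 => 1
  | (m + 2) => aSeq (m + 1) + (m + 1) * aSeq m

/-- The double factorial `k!!`, with the convention `k!! = 0` for even `k ≥ 0`. -/
def oddDF : ℕ → ℕ
  | 0 => 0
  | 1 => 1
  | (k + 2) => (k + 2) * oddDF k

namespace Dgm

variable {n : ℕ}

/-- `{x}` is a singleton upper block of `α`. -/
def UpperSingleton (α : Dgm n) (x : Fin n) : Prop :=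
  ∀ y : PBV n, α.r (Sum.inl x) y → y = Sum.inl x

/-- `{x'}` is a singleton lower block of `α`. -/
def LowerSingleton (α : Dgm n) (x : Fin n) : Prop :=
  ∀ y : PBV n, α.r (Sum.inr x) y → y = Sum.inr x

/-- The upper point `x` is nested: some upper block `{u,v}` has `u < x < v`. -/
def UpperNested (α : Dgm n) (x : Fin n) : Prop :=
  ∃ u v : Fin n, α.r (Sum.inl u) (Sum.inl v) ∧ u < x ∧ x < v

/-- The lower point `x'` is nested: some lower block `{u',v'}` has `u < x < v`. -/
def LowerNested (α : Dgm n) (x : Fin n) : Prop :=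
  ∃ u v : Fin n, α.r (Sum.inr u) (Sum.inr v) ∧ u < x ∧ x < v

/-- `α` has no unnested singleton (upper or lower) block. -/
def NoUnnestedSingleton (α : Dgm n) : Prop :=
  (∀ x, UpperSingleton α x → UpperNested α x) ∧
  (∀ x, LowerSingleton α x → LowerNested α x)

/-- A chain of `d` nested upper hooks of `α` around the upper point `x`:
`u_{d-1} < ⋯ < u_0 < x < v_0 < ⋯ < v_{d-1}` with each `{u_i, v_i}` a block.
The singleton upper block `{x}` has nesting depth at most `k` iff there is no
such chain of length `k + 1`. -/
def UpperHookChain (α : Dgm n) (x : Fin n) (d : ℕ) : Prop :=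
  ∃ u v : Fin d → Fin n,
    (∀ i, α.r (Sum.inl (u i)) (Sum.inl (v i))) ∧
    (∀ i, u i < x ∧ x < v i) ∧ StrictAnti u ∧ StrictMono v

/-- A chain of `d` nested lower hooks of `α` around the lower point `x'`. -/
def LowerHookChain (α : Dgm n) (x : Fin n) (d : ℕ) : Prop :=
  ∃ u v : Fin d → Fin n,
    (∀ i, α.r (Sum.inr (u i)) (Sum.inr (v i))) ∧
    (∀ i, u i < x ∧ x < v i) ∧ StrictAnti u ∧ StrictMono v

/-- `λ_A`: the planar diagram joining the `k`-th smallest element of `A`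
(upper) to `k` (lower), all other blocks being singletons. -/
def lamd (A : Finset (Fin n)) : Dgm n :=
  Setoid.ker (fun x : PBV n =>
    match x with
    | Sum.inl a =>
        if ha : a ∈ A then
          (Sum.inr (((A.orderIsoOfFin rfl).symm ⟨a, ha⟩ : Fin A.card) : ℕ) : ℕ ⊕ ℕ)
        else Sum.inl (a : ℕ)
    | Sum.inr j => Sum.inr (j : ℕ))

/-- `ρ_A = (λ_A)*`. -/
def rhod (A : Finset (Fin n)) : Dgm n := pstar (lamd A)

/-- The diagram whose 2-element blocks are exactly `{i, (π i)'}` for `i < r`. -/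
def permDgm (n r : ℕ) (π : Equiv.Perm (Fin r)) : Dgm n :=
  Setoid.ker (fun x : PBV n =>
    match x with
    | Sum.inl a =>
        if h : (a : ℕ) < r then (Sum.inr ((π ⟨(a : ℕ), h⟩ : Fin r) : ℕ) : ℕ ⊕ ℕ)
        else Sum.inl (a : ℕ)
    | Sum.inr j => Sum.inr (j : ℕ))

/-- The set `S_{[r]} ⊆ PB_n`. -/
def SBr (n r : ℕ) : Set (Dgm n) := {γ | ∃ π : Equiv.Perm (Fin r), γ = permDgm n r π}

/-- The domain of `α` as a `Finset`. -/
def domFinset (α : Dgm n) : Finset (Fin n) :=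
  Finset.univ.filter fun i => i ∈ domSet α

/-- The codomain of `α` as a `Finset`. -/
def codomFinset (α : Dgm n) : Finset (Fin n) :=
  Finset.univ.filter fun i => i ∈ codomSet α

/-- `A ⊆ {1,…,n}` is cosparse: its complement contains no two consecutive
elements. -/
def CosparseS (A : Set (Fin n)) : Prop :=
  ∀ i j : Fin n, i ∉ A → j ∉ A → (j : ℕ) ≠ (i : ℕ) + 1

/-- `id_A`: the diagram with blocks `{a, a'}` for `a ∈ A`, all other blocks
being singletons. -/
def idd (A : Set (Fin n)) : Dgm n :=
  Setoid.ker (fun x : PBV n =>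
    match x with
    | Sum.inl a => if a ∈ A then (Sum.inr (a : ℕ) : ℕ ⊕ ℕ) else Sum.inl (a : ℕ)
    | Sum.inr j => Sum.inr (j : ℕ))

end Dgm

/-! ### Basics -/

namespace PBR

theorem RGen_lift {V W : Type*} {r : V → V → Prop} (F : V → W)
    (hF : ∀ x y, r x y → F x = F y) {x y : V} (h : RGen r x y) : F x = F y := by
  induction h with
  | rel h => exact hF _ _ h
  | refl => rfl
  | symm _ ih => exact ih.symm
  | trans _ _ ih1 ih2 => exact ih1.trans ih2

theorem RGen_map {V W : Type*} {r : V → V → Prop} {s : W → W → Prop} (F : V → W)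
    (hF : ∀ x y, r x y → RGen s (F x) (F y)) {x y : V} (h : RGen r x y) :
    RGen s (F x) (F y) := by
  induction h with
  | rel h => exact hF _ _ h
  | refl => exact RGen.refl _
  | symm _ ih => exact ih.symm
  | trans _ _ ih1 ih2 => exact ih1.trans ih2

/-! Dihedral lemma -/

theorem dihedral_aux {V : Type*} [Finite V] (σ τ : Equiv.Perm V) (hσ : ∀ x, σ (σ x) = x)
    (hτ : ∀ x, τ (τ x) = x) {x y z : V} (hx : τ x = x)
    (hy : σ y = y ∨ τ y = y) (hz : σ z = z ∨ τ z = z)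
    (hxy : RGen (fun a b => b = σ a ∨ b = τ a) x y)
    (hxz : RGen (fun a b => b = σ a ∨ b = τ a) x z) : x = y ∨ x = z ∨ y = z := by
  set ρ : Equiv.Perm V := σ * τ with hρ
  have hσ' : σ⁻¹ = σ := by
    ext v; rw [Equiv.Perm.inv_eq_iff_eq]; exact (hσ v).symm
  have hτ' : τ⁻¹ = τ := by
    ext v; rw [Equiv.Perm.inv_eq_iff_eq]; exact (hτ v).symm
  have hτ2 : τ * τ = 1 := by ext v; simp [hτ]
  have hconj : τ * ρ * τ⁻¹ = ρ⁻¹ := by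
    rw [hρ, mul_inv_rev, hσ', hτ', mul_assoc, mul_assoc, hτ2, mul_one]
  have htau : ∀ k : ℤ, τ ((ρ ^ k) x) = (ρ ^ (-k)) x := by
    intro k
    have : τ * ρ ^ k * τ⁻¹ = ρ ^ (-k) := by
      rw [← conj_zpow, hconj, inv_zpow, zpow_neg]
    rw [← this, hτ']
    simp [hx]
  have hsig : ∀ k : ℤ, σ ((ρ ^ k) x) = (ρ ^ (1 - k)) x := by
    intro k
    have h1 : σ = ρ * τ := by rw [hρ, mul_assoc, hτ2, mul_one]
    rw [sub_eq_add_neg, zpow_add, zpow_one]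
    conv_lhs => rw [h1]
    simp [htau]
  have hO : ∀ u v, RGen (fun a b => b = σ a ∨ b = τ a) u v →
      ((∃ k : ℤ, u = (ρ ^ k) x) ↔ (∃ k : ℤ, v = (ρ ^ k) x)) := by
    intro u v h
    have := RGen_lift (fun u => (∃ k : ℤ, u = (ρ ^ k) x)) (by
      rintro a b (rfl | rfl)
      · refine propext ⟨?_, ?_⟩
        · rintro ⟨k, rfl⟩; exact ⟨_, hsig k⟩
        · rintro ⟨k, hk⟩; refine ⟨1 - k, ?_⟩; rw [← hsig, ← hk, hσ]
      · refine propext ⟨?_, ?_⟩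
        · rintro ⟨k, rfl⟩; exact ⟨_, htau k⟩
        · rintro ⟨k, hk⟩; refine ⟨- k, ?_⟩; rw [← htau, ← hk, hτ]) h
    exact iff_of_eq this
  set m := Function.minimalPeriod (ρ • · : V → V) x with hm
  have hper : ∀ k : ℤ, (ρ ^ k) x = x ↔ (m : ℤ) ∣ k := by
    intro k
    exact MulAction.zpow_smul_eq_iff_minimalPeriod_dvd (a := ρ) (b := x)
  have hmpos : 0 < m := by
    apply Function.minimalPeriod_pos_of_mem_periodicPts
    have : Function.Injective (ρ • · : V → V) := MulAction.injective ρ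
    exact this.mem_periodicPts x
  have hred : ∀ y, RGen (fun a b => b = σ a ∨ b = τ a) x y →
      ∃ k : ℤ, 0 ≤ k ∧ k < m ∧ y = (ρ ^ k) x := by
    intro y h
    obtain ⟨k, hk⟩ := (hO x y h).1 ⟨0, by simp⟩
    refine ⟨k % m, Int.emod_nonneg _ (by omega), Int.emod_lt_of_pos _ (by omega), ?_⟩
    rw [hk]
    conv_lhs => rw [← Int.emod_add_mul_ediv k m, zpow_add, Equiv.Perm.mul_apply]
    rw [(hper _).2 (dvd_mul_right _ _)]
  have hfix : ∀ (y : V) (k : ℤ), 0 ≤ k → k < m → y = (ρ ^ k) x → (σ y = y ∨ τ y = y) →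
      k = 0 ∨ 2 * k = m ∨ 2 * k - 1 = m := by
    intro y k h0 h1 hy h
    subst hy
    rcases h with h | h
    · rw [hsig, ← sub_add_cancel (1 - k) k] at h
      have : (ρ ^ (1 - 2 * k)) x = x := by
        apply (ρ ^ k).injective
        rw [← Equiv.Perm.mul_apply, ← zpow_add]
        convert h using 3; ring
      rw [hper] at this
      obtain ⟨c, hc⟩ := this
      have hc1 : c ≤ 1 := by by_contra!; nlinarith
      have hc2 : -2 < c := by by_contra!; nlinarith
      have : c = 1 ∨ c = 0 ∨ c = -1 := by omega
      rcases this with rfl | rfl | rfl <;> omega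
    · have : (ρ ^ (- 2 * k)) x = x := by
        apply (ρ ^ k).injective
        rw [← Equiv.Perm.mul_apply, ← zpow_add]
        rw [htau] at h
        convert h using 3; ring
      rw [hper] at this
      obtain ⟨c, hc⟩ := this
      have hc1 : c ≤ 0 := by by_contra!; nlinarith
      have hc2 : -2 < c := by by_contra!; nlinarith
      have : c = 0 ∨ c = -1 := by omega
      rcases this with rfl | rfl <;> omega
  obtain ⟨k, hk0, hk1, hk⟩ := hred y hxy
  obtain ⟨l, hl0, hl1, hl⟩ := hred z hxz
  have h1 := hfix y k hk0 hk1 hk hy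
  have h2 := hfix z l hl0 hl1 hl hz
  have : k = 0 ∨ l = 0 ∨ k = l := by omega
  rcases this with rfl | rfl | rfl
  · left; simp [hk]
  · right; left; simp [hl]
  · right; right; rw [hk, hl]

theorem dihedral {V : Type*} [Finite V] (σ τ : V → V) (hσ : ∀ x, σ (σ x) = x)
    (hτ : ∀ x, τ (τ x) = x) {x y z : V} (hx : σ x = x ∨ τ x = x)
    (hy : σ y = y ∨ τ y = y) (hz : σ z = z ∨ τ z = z)
    (hxy : RGen (fun a b => b = σ a ∨ b = τ a) x y)
    (hxz : RGen (fun a b => b = σ a ∨ b = τ a) x z) : x = y ∨ x = z ∨ y = z := by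
  let S : Equiv.Perm V := ⟨σ, σ, hσ, hσ⟩
  let T : Equiv.Perm V := ⟨τ, τ, hτ, hτ⟩
  rcases hx with hx | hx
  · have e : (fun a b => b = σ a ∨ b = τ a) = (fun a b => b = T a ∨ b = S a) := by
      funext a b; exact propext or_comm
    rw [e] at hxy hxz
    exact dihedral_aux T S hτ hσ hx hy.symm hz.symm hxy hxz
  · exact dihedral_aux S T hσ hτ hx hy hz hxy hxz

variable {n : ℕ}

/-- partner function -/
def ptn (α : Dgm n) (x : PBV n) : PBV n :=
  if h : ∃ y, y ≠ x ∧ α.r x y then h.choose else x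

theorem ptn_spec {α : Dgm n} (hα : IsPB α) {x y : PBV n} (h : α.r x y) (hne : y ≠ x) :
    ptn α x = y := by
  have hex : ∃ y, y ≠ x ∧ α.r x y := ⟨y, hne, h⟩
  rw [ptn, dif_pos hex]
  have := hex.choose_spec
  rcases hα x _ _ h this.2 with h | h | h
  · exact absurd h.symm hne
  · exact absurd h.symm this.1
  · exact h.symm

theorem ptn_rel (α : Dgm n) (x : PBV n) : α.r x (ptn α x) := by
  unfold ptn
  split_ifs with h
  · exact h.choose_spec.2
  · exact α.iseqv.refl _

theorem ptn_ptn {α : Dgm n} (hα : IsPB α) (x : PBV n) : ptn α (ptn α x) = x := by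
  by_cases h : ptn α x = x
  · rw [h, h]
  · exact ptn_spec hα (α.iseqv.symm (ptn_rel α x)) (Ne.symm h)

def sg (α : Dgm n) : V3 n → V3 n
  | Sum.inl i => topMid (ptn α (Sum.inl i))
  | Sum.inr (Sum.inl i) => topMid (ptn α (Sum.inr i))
  | Sum.inr (Sum.inr i) => Sum.inr (Sum.inr i)

def ta (α : Dgm n) : V3 n → V3 n
  | Sum.inl i => Sum.inl i
  | Sum.inr (Sum.inl i) => midBot (ptn α (Sum.inl i))
  | Sum.inr (Sum.inr i) => midBot (ptn α (Sum.inr i))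

theorem sg_topMid (α : Dgm n) (x : PBV n) : sg α (topMid x) = topMid (ptn α x) := by
  cases x <;> rfl

theorem ta_midBot (α : Dgm n) (x : PBV n) : ta α (midBot x) = midBot (ptn α x) := by
  cases x <;> rfl

theorem topBot_inj : Function.Injective (topBot (n := n)) := by
  rintro (a | a) (b | b) h <;> simp_all [topBot]

theorem isPB_pmul {α β : Dgm n} (hα : IsPB α) (hβ : IsPB β) : IsPB (pmul α β) := by
  have hs : ∀ x, sg α (sg α x) = x := by
    rintro (i | i | i)
    · change sg α (topMid _) = topMid (Sum.inl i)
      rw [sg_topMid, ptn_ptn hα]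
    · change sg α (topMid _) = topMid (Sum.inr i)
      rw [sg_topMid, ptn_ptn hα]
    · rfl
  have ht : ∀ x, ta β (ta β x) = x := by
    rintro (i | i | i)
    · rfl
    · change ta β (midBot _) = midBot (Sum.inl i)
      rw [ta_midBot, ptn_ptn hβ]
    · change ta β (midBot _) = midBot (Sum.inr i)
      rw [ta_midBot, ptn_ptn hβ]
  have hfix : ∀ x : PBV n, sg α (topBot x) = topBot x ∨ ta β (topBot x) = topBot x := by
    rintro (i | i)
    · right; rfl
    · left; rfl
  have hconv : ∀ x y, RGen (prodEdges α β) x y →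
      RGen (fun a b => b = sg α a ∨ b = ta β a) x y := by
    intro x y h
    refine RGen_map id ?_ h
    rintro x y (⟨a, b, h, rfl, rfl⟩ | ⟨a, b, h, rfl, rfl⟩)
    · by_cases hab : b = a
      · subst hab; exact RGen.refl _
      · refine RGen.rel (Or.inl ?_)
        simp only [id, sg_topMid, ptn_spec hα h hab]
    · by_cases hab : b = a
      · subst hab; exact RGen.refl _
      · refine RGen.rel (Or.inr ?_)
        simp only [id, ta_midBot, ptn_spec hβ h hab]
  intro x y z hxy hxz
  have := dihedral (sg α) (ta β) hs ht (hfix x) (hfix y) (hfix z) (hconv _ _ hxy) (hconv _ _ hxz)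
  rcases this with h | h | h
  · exact Or.inl (topBot_inj h)
  · exact Or.inr (Or.inl (topBot_inj h))
  · exact Or.inr (Or.inr (topBot_inj h))

/-! star -/

def flip3 : V3 n → V3 n
  | Sum.inl i => Sum.inr (Sum.inr i)
  | Sum.inr (Sum.inl i) => Sum.inr (Sum.inl i)
  | Sum.inr (Sum.inr i) => Sum.inl i

theorem swap_swap (x : PBV n) : swapUD (swapUD x) = x := by cases x <;> rfl

theorem pstar_pstar (α : Dgm n) : pstar (pstar α) = α := by
  ext x y
  change α.r _ _ ↔ α.r _ _
  rw [swap_swap, swap_swap]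

theorem flip_topMid (x : PBV n) : flip3 (topMid x) = midBot (swapUD x) := by cases x <;> rfl
theorem flip_midBot (x : PBV n) : flip3 (midBot x) = topMid (swapUD x) := by cases x <;> rfl
theorem flip_topBot (x : PBV n) : flip3 (topBot x) = topBot (swapUD x) := by cases x <;> rfl

theorem star_aux (α β : Dgm n) (x y : V3 n) (h : RGen (prodEdges α β) x y) :
    RGen (prodEdges (pstar β) (pstar α)) (flip3 x) (flip3 y) := by
  refine RGen_map flip3 ?_ h
  rintro x y (⟨a, b, h, rfl, rfl⟩ | ⟨a, b, h, rfl, rfl⟩)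
  · refine RGen.rel (Or.inr ⟨swapUD a, swapUD b, ?_, flip_topMid _, flip_topMid _⟩)
    change α.r _ _
    rwa [swap_swap, swap_swap]
  · refine RGen.rel (Or.inl ⟨swapUD a, swapUD b, ?_, flip_midBot _, flip_midBot _⟩)
    change β.r _ _
    rwa [swap_swap, swap_swap]

theorem pstar_pmul (α β : Dgm n) : pstar (pmul α β) = pmul (pstar β) (pstar α) := by
  ext x y
  change RGen (prodEdges α β) (topBot (swapUD x)) (topBot (swapUD y)) ↔
    RGen (prodEdges (pstar β) (pstar α)) (topBot x) (topBot y)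
  constructor
  · intro h
    have := star_aux _ _ _ _ h
    rwa [flip_topBot, flip_topBot, swap_swap, swap_swap] at this
  · intro h
    have := star_aux _ _ _ _ h
    rwa [flip_topBot, flip_topBot, pstar_pstar, pstar_pstar] at this

/-! singles and tops -/

theorem pmul_upsing {α β : Dgm n} {a : Fin n} (h : ∀ y, α.r (Sum.inl a) y → y = Sum.inl a)
    (y : PBV n) (hy : (pmul α β).r (Sum.inl a) y) : y = Sum.inl a := by
  have := RGen_lift (r := prodEdges α β) (fun v : V3 n => v = Sum.inl a) (by
    rintro x y (⟨u, v, h', rfl, rfl⟩ | ⟨u, v, h', rfl, rfl⟩)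
    · refine propext ⟨?_, ?_⟩
      · intro hu
        have : u = Sum.inl a := by cases u <;> simp_all [topMid]
        subst this
        rw [h _ h']; rfl
      · intro hu
        have : v = Sum.inl a := by cases v <;> simp_all [topMid]
        subst this
        rw [h _ (α.iseqv.symm h')]; rfl
    · cases u <;> cases v <;> simp [midBot]) hy
  have h2 : topBot y = Sum.inl a := by
    have e : topBot (Sum.inl a) = (Sum.inl a : V3 n) := rfl
    rw [e] at this
    simpa using this
  cases y <;> simp_all [topBot]

theorem pmul_losing {α β : Dgm n} {a : Fin n} (h : ∀ y, β.r (Sum.inr a) y → y = Sum.inr a)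
    (y : PBV n) (hy : (pmul α β).r (Sum.inr a) y) : y = Sum.inr a := by
  have h1 : (pmul (pstar β) (pstar α)).r (Sum.inl a) (swapUD y) := by
    rw [← pstar_pmul]
    change (pmul α β).r _ (swapUD (swapUD y))
    rw [swap_swap]; exact hy
  have := pmul_upsing (α := pstar β) (β := pstar α) (a := a) (by
    intro y hy
    have := h (swapUD y) hy
    cases y <;> simp_all [swapUD]) _ h1
  cases y <;> simp_all [swapUD]

theorem pmul_up {α β : Dgm n} {i j : Fin n} (h : α.r (Sum.inl i) (Sum.inl j)) :
    (pmul α β).r (Sum.inl i) (Sum.inl j) :=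
  RGen.rel (Or.inl ⟨_, _, h, rfl, rfl⟩)

theorem pmul_lo {α β : Dgm n} {i j : Fin n} (h : β.r (Sum.inr i) (Sum.inr j)) :
    (pmul α β).r (Sum.inr i) (Sum.inr j) :=
  RGen.rel (Or.inr ⟨_, _, h, rfl, rfl⟩)

theorem dom_pmul {α β : Dgm n} (hα : IsPB α) (hβ : IsPB β) :
    domSet (pmul α β) ⊆ domSet α := by
  rintro i ⟨j, hj⟩
  by_contra hi
  by_cases hs : ∀ y, α.r (Sum.inl i) y → y = Sum.inl i
  · have := pmul_upsing hs _ hj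
    simp at this
  · push Not at hs
    obtain ⟨y, hy, hne⟩ := hs
    rcases y with k | k
    · have := isPB_pmul hα hβ _ _ _ (pmul_up (β := β) hy) hj
      simp at this
      exact hne (by rw [this])
    · exact hi ⟨k, hy⟩

theorem up_pmul_iff {α β : Dgm n} (hα : IsPB α) (hβ : IsPB β)
    (hd : domSet (pmul α β) = domSet α) (i j : Fin n) :
    (pmul α β).r (Sum.inl i) (Sum.inl j) ↔ α.r (Sum.inl i) (Sum.inl j) := by
  refine ⟨fun h => ?_, pmul_up⟩
  by_cases hij : i = j
  · subst hij; exact α.iseqv.refl _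
  by_cases hs : ∀ y, α.r (Sum.inl i) y → y = Sum.inl i
  · have := pmul_upsing hs _ h
    simp at this
    exact absurd this.symm hij
  · push Not at hs
    obtain ⟨y, hy, hne⟩ := hs
    rcases y with k | k
    · have := isPB_pmul hα hβ _ _ _ (pmul_up (β := β) hy) h
      simp at this
      rcases this with h | h | h
      · exact absurd (by rw [h]) hne
      · exact absurd h hij
      · subst h; exact hy
    · exfalso
      have : i ∈ domSet (pmul α β) := by rw [hd]; exact ⟨k, hy⟩
      obtain ⟨l, hl⟩ := this
      have := isPB_pmul hα hβ _ _ _ h hl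
      simp at this
      exact hij this

/-- verification principle -/
theorem pmul_eq_of {α β γ : Dgm n} (hα : IsPB α) (hβ : IsPB β)
    (h1 : ∀ x y, γ.r x y → (pmul α β).r x y)
    (h2 : ∀ x, (∀ y, γ.r x y → y = x) → ∀ y, (pmul α β).r x y → y = x) :
    pmul α β = γ := by
  ext x y
  refine ⟨fun h => ?_, h1 x y⟩
  by_cases hs : ∀ y, γ.r x y → y = x
  · rw [h2 x hs y h]
  · push Not at hs
    obtain ⟨z, hz, hne⟩ := hs
    rcases isPB_pmul hα hβ _ _ _ h (h1 _ _ hz) with e | e | e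
    · subst e; exact γ.iseqv.refl _
    · exact absurd e.symm hne
    · subst e; exact hz

end PBR
/-! ### Explicit diagrams -/

namespace PBR

@[ext] structure PD (n : ℕ) where
  U : Fin n → Fin n → Prop
  T : Fin n → Fin n → Prop
  L : Fin n → Fin n → Prop
  Usym : ∀ i j, U i j → U j i
  Uirr : ∀ i, ¬ U i i
  Uun : ∀ i j k, U i j → U i k → j = k
  Lsym : ∀ i j, L i j → L j i
  Lirr : ∀ i, ¬ L i i
  Lun : ∀ i j k, L i j → L i k → j = k
  Tl : ∀ i j k, T i j → T i k → j = k
  Tr : ∀ i j k, T i k → T j k → i = j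
  UT : ∀ i j k, U i j → ¬ T i k
  LT : ∀ i j k, L i j → ¬ T k i

variable {n : ℕ}

namespace PD

def rel (d : PD n) : PBV n → PBV n → Prop
  | Sum.inl i, Sum.inl j => i = j ∨ d.U i j
  | Sum.inl i, Sum.inr j => d.T i j
  | Sum.inr j, Sum.inl i => d.T i j
  | Sum.inr i, Sum.inr j => i = j ∨ d.L i j

theorem rel_refl (d : PD n) (x : PBV n) : d.rel x x := by
  cases x <;> simp [rel]

theorem rel_symm (d : PD n) {x y : PBV n} (h : d.rel x y) : d.rel y x := by
  have := d.Usym; have := d.Lsym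
  rcases x with i | i <;> rcases y with j | j <;> simp only [rel] at * <;> grind

theorem rel_trans (d : PD n) {x y z : PBV n} (h : d.rel x y) (h' : d.rel y z) : d.rel x z := by
  have h1 := d.Usym; have h2 := d.Lsym; have h3 := d.Uun; have h4 := d.Lun
  have h5 := d.Tl; have h6 := d.Tr; have h7 := d.UT; have h8 := d.LT
  rcases x with i | i <;> rcases y with j | j <;> rcases z with k | k <;>
    simp only [rel] at * <;> grind

def D (d : PD n) : Dgm n where
  r := d.rel
  iseqv := ⟨d.rel_refl, d.rel_symm, d.rel_trans⟩

theorem isPB (d : PD n) : IsPB d.D := by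
  have h1 := d.Usym; have h2 := d.Lsym; have h3 := d.Uun; have h4 := d.Lun
  have h5 := d.Tl; have h6 := d.Tr; have h7 := d.UT; have h8 := d.LT
  intro x y z h h'
  change d.rel x y at h
  change d.rel x z at h'
  rcases x with i | i <;> rcases y with j | j <;> rcases z with k | k <;>
    simp only [rel, reduceCtorEq, Sum.inl.injEq, Sum.inr.injEq] at * <;> grind

theorem exists_of_isPB {α : Dgm n} (hα : IsPB α) : ∃ d : PD n, d.D = α := by
  have hs : ∀ {x y}, α.r x y → α.r y x := fun h => α.iseqv.symm h
  have key : ∀ x y z, α.r x y → α.r x z → y ≠ x → z ≠ x → y = z := by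
    intro x y z h h' h1 h2
    rcases hα x y z h h' with e | e | e
    · exact absurd e.symm h1
    · exact absurd e.symm h2
    · exact e
  refine ⟨⟨fun i j => i ≠ j ∧ α.r (Sum.inl i) (Sum.inl j), fun i j => α.r (Sum.inl i) (Sum.inr j),
    fun i j => i ≠ j ∧ α.r (Sum.inr i) (Sum.inr j), ?_, ?_, ?_, ?_, ?_, ?_, ?_, ?_, ?_, ?_⟩, ?_⟩
  · exact fun i j h => ⟨h.1.symm, hs h.2⟩
  · exact fun i h => h.1 rfl
  · intro i j k h h'
    have := key _ _ _ h.2 h'.2 (by simpa using h.1.symm) (by simpa using h'.1.symm)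
    simpa using this
  · exact fun i j h => ⟨h.1.symm, hs h.2⟩
  · exact fun i h => h.1 rfl
  · intro i j k h h'
    have := key _ _ _ h.2 h'.2 (by simpa using h.1.symm) (by simpa using h'.1.symm)
    simpa using this
  · intro i j k h h'
    have := key _ _ _ h h' (by simp) (by simp)
    simpa using this
  · intro i j k h h'
    have := key _ _ _ (hs h) (hs h') (by simp) (by simp)
    simpa using this
  · intro i j k h h'
    have := key _ _ _ h.2 h' (by simpa using h.1.symm) (by simp)
    simp at this
  · intro i j k h h'
    have := key _ _ _ h.2 (hs h') (by simpa using h.1.symm) (by simp)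
    simp at this
  · ext x y
    change rel _ x y ↔ α.r x y
    rcases x with i | i <;> rcases y with j | j <;> simp only [rel]
    · by_cases h : i = j
      · subst h; simp
      · simp [h]
    · exact ⟨hs, hs⟩
    · by_cases h : i = j
      · subst h; simp
      · simp [h]

def dom (d : PD n) : Set (Fin n) := {i | ∃ j, d.T i j}
def cod (d : PD n) : Set (Fin n) := {j | ∃ i, d.T i j}

theorem domSet_D (d : PD n) : domSet d.D = d.dom := rfl

theorem ncard_cod (d : PD n) : d.cod.ncard = d.dom.ncard := by
  symm
  refine Set.ncard_congr (fun i hi => hi.choose) ?_ ?_ ?_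
  · intro i hi; exact ⟨i, hi.choose_spec⟩
  · intro i j hi hj h
    have h1 := hi.choose_spec
    have h2 := hj.choose_spec
    change hi.choose = hj.choose at h
    rw [← h] at h2
    exact d.Tr _ _ _ h1 h2
  · rintro j ⟨i, hi⟩
    exact ⟨i, ⟨j, hi⟩, d.Tl _ _ _ (Exists.choose_spec (⟨j, hi⟩ : ∃ j, d.T i j)) hi⟩

def star (d : PD n) : PD n where
  U := d.L
  T i j := d.T j i
  L := d.U
  Usym := d.Lsym
  Uirr := d.Lirr
  Uun := d.Lun
  Lsym := d.Usym
  Lirr := d.Uirr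
  Lun := d.Uun
  Tl _ _ _ h h' := d.Tr _ _ _ h h'
  Tr _ _ _ h h' := d.Tl _ _ _ h h'
  UT _ _ _ h h' := d.LT _ _ _ h h'
  LT _ _ _ h h' := d.UT _ _ _ h h'

theorem star_star (d : PD n) : d.star.star = d := rfl

theorem star_D (d : PD n) : d.star.D = pstar d.D := by
  ext x y
  change d.star.rel x y ↔ d.rel (swapUD x) (swapUD y)
  rcases x with i | i <;> rcases y with j | j <;> rfl

/-- product when the right factor has no upper hooks -/
theorem mul_simple (d e c : PD n) (he : ∀ i j, ¬ e.U i j)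
    (hU : ∀ i j, c.U i j ↔ d.U i j) (hT : ∀ i j, c.T i j ↔ ∃ k, d.T i k ∧ e.T k j)
    (hL : ∀ i j, c.L i j ↔ e.L i j ∨ ∃ k l, d.L k l ∧ e.T k i ∧ e.T l j) :
    pmul d.D e.D = c.D := by
  have pd : ∀ {x y}, d.rel x y → RGen (prodEdges d.D e.D) (topMid x) (topMid y) :=
    fun h => RGen.rel (Or.inl ⟨_, _, h, rfl, rfl⟩)
  have pe : ∀ {x y}, e.rel x y → RGen (prodEdges d.D e.D) (midBot x) (midBot y) :=
    fun h => RGen.rel (Or.inr ⟨_, _, h, rfl, rfl⟩)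
  have pT : ∀ {k j}, e.T k j →
      RGen (prodEdges d.D e.D) (Sum.inr (Sum.inl k)) (Sum.inr (Sum.inr j)) :=
    fun {k j} h => pe (x := Sum.inl k) (y := Sum.inr j) h
  have hTT : ∀ {i j}, c.T i j → RGen (prodEdges d.D e.D) (Sum.inl i) (Sum.inr (Sum.inr j)) := by
    intro i j h
    obtain ⟨k, h1, h2⟩ := (hT _ _).1 h
    exact RGen.trans (pd (x := Sum.inl i) (y := Sum.inr k) h1) (pT h2)
  ext x y
  change RGen (prodEdges d.D e.D) (topBot x) (topBot y) ↔ c.rel x y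
  constructor
  · intro h
    let F : V3 n → Quotient d.D ⊕ Quotient e.D := fun v => match v with
      | Sum.inl i => Sum.inl (Quotient.mk d.D (Sum.inl i))
      | Sum.inr (Sum.inl i) => Sum.inl (Quotient.mk d.D (Sum.inr i))
      | Sum.inr (Sum.inr j) =>
        if h : ∃ k, e.T k j then Sum.inl (Quotient.mk d.D (Sum.inr h.choose))
        else Sum.inr (Quotient.mk e.D (Sum.inr j))
    have FT : ∀ k j, e.T k j →
        F (Sum.inr (Sum.inr j)) = Sum.inl (Quotient.mk d.D (Sum.inr k)) := by
      intro k j h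
      have hex : ∃ k, e.T k j := ⟨k, h⟩
      simp only [F, dif_pos hex]
      rw [e.Tr _ _ _ hex.choose_spec h]
    have FN : ∀ j, (¬ ∃ k, e.T k j) →
        F (Sum.inr (Sum.inr j)) = Sum.inr (Quotient.mk e.D (Sum.inr j)) := by
      intro j h
      simp only [F, dif_neg h]
    have hF := RGen_lift F (by
      rintro x y (⟨a, b, h, rfl, rfl⟩ | ⟨a, b, h, rfl, rfl⟩)
      · have : Quotient.mk d.D a = Quotient.mk d.D b := Quotient.sound h
        rcases a with a | a <;> rcases b with b | b <;> simp only [topMid, F, this]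
      · change e.rel a b at h
        rcases a with a | a <;> rcases b with b | b <;> simp only [rel] at h
        · have : a = b := by simpa [he] using h
          rw [this]
        · change F (Sum.inr (Sum.inl a)) = F (Sum.inr (Sum.inr b))
          rw [FT _ _ h]
        · change F (Sum.inr (Sum.inr a)) = F (Sum.inr (Sum.inl b))
          rw [FT _ _ h]
        · change F (Sum.inr (Sum.inr a)) = F (Sum.inr (Sum.inr b))
          rcases h with h | h
          · rw [h]
          · rw [FN, FN]
            · congr 1; exact Quotient.sound (Or.inr h)
            · rintro ⟨k, hk⟩; exact e.LT _ _ _ (e.Lsym _ _ h) hk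
            · rintro ⟨k, hk⟩; exact e.LT _ _ _ h hk) h
    have hud : ∀ i j, F (Sum.inl i) = F (Sum.inr (Sum.inr j)) → c.T i j := by
      intro i j h
      by_cases hj : ∃ k, e.T k j
      · obtain ⟨k, hk⟩ := hj
        rw [FT _ _ hk] at h
        simp only [F, Sum.inl.injEq] at h
        have : d.rel (Sum.inl i) (Sum.inr k) := Quotient.exact h
        exact (hT _ _).2 ⟨k, this, hk⟩
      · rw [FN _ hj] at h
        simp [F] at h
    rcases x with i | i <;> rcases y with j | j <;> simp only [topBot] at hF
    · simp only [F, Sum.inl.injEq] at hF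
      have : d.rel (Sum.inl i) (Sum.inl j) := Quotient.exact hF
      simpa only [rel, hU] using this
    · exact hud _ _ hF
    · exact hud _ _ hF.symm
    · simp only [rel]
      by_cases hi : ∃ k, e.T k i <;> by_cases hj : ∃ k, e.T k j
      · obtain ⟨k, hk⟩ := hi
        obtain ⟨l, hl⟩ := hj
        rw [FT _ _ hk, FT _ _ hl] at hF
        have : d.rel (Sum.inr k) (Sum.inr l) := Quotient.exact (Sum.inl.inj hF)
        rcases this with h | h
        · subst h; left; exact e.Tl _ _ _ hk hl
        · right; rw [hL]; right; exact ⟨k, l, h, hk, hl⟩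
      · obtain ⟨k, hk⟩ := hi
        rw [FT _ _ hk, FN _ hj] at hF
        simp at hF
      · obtain ⟨k, hk⟩ := hj
        rw [FT _ _ hk, FN _ hi] at hF
        simp at hF
      · rw [FN _ hi, FN _ hj] at hF
        have : e.rel (Sum.inr i) (Sum.inr j) := Quotient.exact (Sum.inr.inj hF)
        rcases this with h | h
        · exact Or.inl h
        · exact Or.inr ((hL _ _).2 (Or.inl h))
  · intro h
    rcases x with i | i <;> rcases y with j | j <;> simp only [rel] at h
    · rw [hU] at h
      exact pd (x := Sum.inl i) (y := Sum.inl j) h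
    · exact hTT h
    · exact (hTT h).symm
    · rw [hL] at h
      rcases h with h | h | ⟨k, l, h1, h2, h3⟩
      · subst h; exact RGen.refl _
      · exact pe (x := Sum.inr i) (y := Sum.inr j) (Or.inr h)
      · exact ((pT h2).symm.trans (pd (x := Sum.inr k) (y := Sum.inr l) (Or.inr h1))).trans (pT h3)

/-- product when the left factor has no lower hooks -/
theorem mul_simple' (d e c : PD n) (hd : ∀ i j, ¬ d.L i j)
    (hL : ∀ i j, c.L i j ↔ e.L i j) (hT : ∀ i j, c.T i j ↔ ∃ k, d.T i k ∧ e.T k j)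
    (hU : ∀ i j, c.U i j ↔ d.U i j ∨ ∃ k l, e.U k l ∧ d.T i k ∧ d.T j l) :
    pmul d.D e.D = c.D := by
  have := mul_simple e.star d.star c.star hd hL (by
    intro i j
    change c.T j i ↔ ∃ k, e.T k i ∧ d.T j k
    rw [hT]
    exact exists_congr fun _ => and_comm) hU
  rw [← pstar_pstar (pmul d.D e.D), pstar_pmul, ← star_D, ← star_D, this, star_D, pstar_pstar]

/-! constructions -/

/-- projection `(A,f)` -/
def prj (A : Finset (Fin n)) (f : Equiv.Perm (Fin n)) : PD n where
  U i j := i ≠ j ∧ f i = j ∧ f j = i ∧ i ∉ A ∧ j ∉ A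
  T i j := i = j ∧ i ∈ A
  L i j := i ≠ j ∧ f i = j ∧ f j = i ∧ i ∉ A ∧ j ∉ A
  Usym := by grind
  Uirr := by grind
  Uun := by grind
  Lsym := by grind
  Lirr := by grind
  Lun := by grind
  Tl := by grind
  Tr := by grind
  UT := by grind
  LT := by grind

def lowS (d : PD n) : PD n where
  U := d.U
  T := d.T
  L _ _ := False
  Usym := d.Usym
  Uirr := d.Uirr
  Uun := d.Uun
  Lsym := by simp
  Lirr := by simp
  Lun := by simp
  Tl := d.Tl
  Tr := d.Tr
  UT := d.UT
  LT := by simp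

def mid (d : PD n) : PD n where
  U _ _ := False
  T := d.T
  L _ _ := False
  Usym := by simp
  Uirr := by simp
  Uun := by simp
  Lsym := by simp
  Lirr := by simp
  Lun := by simp
  Tl := d.Tl
  Tr := d.Tr
  UT := by simp
  LT := by simp

/-- the upper projection -/
def pe (d : PD n) : PD n where
  U := d.U
  T i j := i = j ∧ i ∈ d.dom
  L := d.U
  Usym := d.Usym
  Uirr := d.Uirr
  Uun := d.Uun
  Lsym := d.Usym
  Lirr := d.Uirr
  Lun := d.Uun
  Tl := by grind
  Tr := by grind
  UT := by
    rintro i j k h ⟨rfl, l, hl⟩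
    exact d.UT _ _ _ h hl
  LT := by
    rintro i j k h ⟨rfl, l, hl⟩
    exact d.UT _ _ _ h hl

theorem dom_pe (d : PD n) : d.pe.dom = d.dom := by
  ext i
  constructor
  · rintro ⟨j, rfl, h⟩; exact h
  · intro h; exact ⟨i, rfl, h⟩

theorem dom_star (d : PD n) : d.star.dom = d.cod := rfl

def bij (A : Set (Fin n)) (σ : Equiv.Perm (Fin n)) : PD n where
  U _ _ := False
  T i j := i ∈ A ∧ σ i = j
  L _ _ := False
  Usym := by simp
  Uirr := by simp
  Uun := by simp
  Lsym := by simp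
  Lirr := by simp
  Lun := by simp
  Tl := by grind
  Tr := by
    rintro i j k ⟨_, h⟩ ⟨_, h'⟩
    exact σ.injective (h.trans h'.symm)
  UT := by simp
  LT := by simp

theorem dom_bij (A : Set (Fin n)) (σ : Equiv.Perm (Fin n)) : (bij A σ).dom = A := by
  ext i; simp [dom, bij]

theorem eq_pe_mid (d : PD n) : pmul d.pe.D d.mid.D = d.lowS.D := by
  refine mul_simple _ _ _ (fun _ _ h => h) (fun _ _ => Iff.rfl) ?_ ?_
  · intro i j
    constructor
    · intro h; exact ⟨i, ⟨rfl, j, h⟩, h⟩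
    · rintro ⟨k, ⟨rfl, _⟩, h⟩; exact h
  · intro i j
    refine ⟨fun h => h.elim, ?_⟩
    rintro (h | ⟨k, l, h, h', _⟩)
    · exact h
    · exact d.UT _ _ _ h h'

theorem eq_low_up (d : PD n) : pmul d.lowS.D d.star.pe.lowS.star.D = d.D := by
  refine mul_simple _ _ _ (fun _ _ h => h) (fun _ _ => Iff.rfl) ?_ ?_
  · intro i j
    constructor
    · intro h; exact ⟨j, h, rfl, i, h⟩
    · rintro ⟨k, h, rfl, _⟩; exact h
  · intro i j
    constructor
    · intro h; exact Or.inl h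
    · rintro (h | ⟨k, l, h, _⟩)
      · exact h
      · exact h.elim

theorem mid_eq_bij (d : PD n) : ∃ σ, d.mid = bij d.dom σ := by
  let f : {i // i ∈ d.dom} ≃ {i // i ∈ d.cod} :=
    Equiv.ofBijective (fun i => ⟨i.2.choose, i.1, i.2.choose_spec⟩) (by
      constructor
      · rintro ⟨i, hi⟩ ⟨j, hj⟩ h
        have h1 := hi.choose_spec
        have h2 := hj.choose_spec
        replace h := congrArg Subtype.val h
        change hi.choose = hj.choose at h
        rw [← h] at h2
        exact Subtype.ext (d.Tr _ _ _ h1 h2)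
      · rintro ⟨j, i, hi⟩
        exact ⟨⟨i, j, hi⟩, Subtype.ext
          (d.Tl _ _ _ (Exists.choose_spec (⟨j, hi⟩ : ∃ j, d.T i j)) hi)⟩)
  refine ⟨f.extendSubtype, ?_⟩
  have hf : ∀ i (hi : i ∈ d.dom), d.T i (f.extendSubtype i) := by
    intro i hi
    rw [Equiv.extendSubtype_apply_of_mem f i hi]
    exact hi.choose_spec
  ext i j
  · rfl
  · constructor
    · intro h
      exact ⟨⟨j, h⟩, d.Tl _ _ _ (hf i ⟨j, h⟩) h⟩
    · rintro ⟨h, rfl⟩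
      exact hf i h
  · rfl

/-- the upper pattern as an involution -/
theorem exists_inv (d : PD n) : ∃ f : Equiv.Perm (Fin n), f * f = 1 ∧
    (∀ i j, d.U i j ↔ i ≠ j ∧ f i = j) := by
  let g : Fin n → Fin n := fun i => if h : ∃ j, d.U i j then h.choose else i
  have g1 : ∀ i j, d.U i j → g i = j := by
    intro i j h
    have hex : ∃ j, d.U i j := ⟨j, h⟩
    simp only [g, dif_pos hex]
    exact d.Uun _ _ _ hex.choose_spec h
  have g2 : ∀ i, (¬ ∃ j, d.U i j) → g i = i := by
    intro i h; simp only [g, dif_neg h]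
  have gg : ∀ i, g (g i) = i := by
    intro i
    by_cases h : ∃ j, d.U i j
    · obtain ⟨j, hj⟩ := h
      rw [g1 _ _ hj, g1 _ _ (d.Usym _ _ hj)]
    · rw [g2 _ h, g2 _ h]
  refine ⟨⟨g, g, gg, gg⟩, ?_, ?_⟩
  · ext i; simp [gg]
  · intro i j
    constructor
    · intro h
      refine ⟨?_, g1 _ _ h⟩
      rintro rfl; exact d.Uirr _ h
    · rintro ⟨h, h'⟩
      change g i = j at h'
      by_cases hi : ∃ j, d.U i j
      · obtain ⟨k, hk⟩ := hi
        rw [g1 _ _ hk] at h'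
        subst h'; exact hk
      · rw [g2 _ hi] at h'
        exact absurd h' h

theorem prj_idem (A : Finset (Fin n)) (f : Equiv.Perm (Fin n)) :
    pmul (prj A f).D (prj A f).D = (prj A f).D := by
  have hT : ∀ i ∈ A, (pmul (prj A f).D (prj A f).D).r (Sum.inl i) (Sum.inr i) := by
    intro i hi
    refine RGen.trans (y := Sum.inr (Sum.inl i)) (RGen.rel (Or.inl ⟨Sum.inl i, Sum.inr i, ⟨rfl, hi⟩, rfl, rfl⟩))
      (RGen.rel (Or.inr ⟨Sum.inl i, Sum.inr i, ⟨rfl, hi⟩, rfl, rfl⟩))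
  refine pmul_eq_of (isPB _) (isPB _) ?_ ?_
  · rintro (i | i) (j | j) h
    · exact pmul_up h
    · obtain ⟨rfl, h⟩ := h; exact hT _ h
    · obtain ⟨rfl, h⟩ := h; exact (hT _ h).symm
    · exact pmul_lo h
  · rintro (i | i) h
    · exact pmul_upsing h
    · exact pmul_losing h

end PD

end PBR
/-! ### Generation -/

namespace PBR

variable {n : ℕ}
open PD

structure Hyp (n r : ℕ) (P : Set (Dgm n)) : Prop where
  hr : r + 2 ≤ n
  mul : ∀ a b, a ∈ P → b ∈ P → pmul a b ∈ P
  star : ∀ a, a ∈ P → pstar a ∈ P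
  h1 : ∀ d : PD n, d.dom.ncard = r → d.pe.D ∈ P
  h2 : ∀ d : PD n, d.dom.ncard + 1 = r → (∀ i, i ∈ d.dom ∨ ∃ j, d.U i j) → d.pe.D ∈ P

theorem exists_not_mem (A : Set (Fin n)) (h : A.ncard < n) : ∃ x, x ∉ A := by
  by_contra! hA
  have : A = Set.univ := Set.eq_univ_of_forall hA
  rw [this, Set.ncard_univ] at h
  simp at h

namespace Hyp

variable {r : ℕ} {P : Set (Dgm n)}

theorem bij_one (H : Hyp n r P) (A : Set (Fin n)) (hA : A.ncard = r) : (bij A 1).D ∈ P := by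
  have := H.h1 (bij A 1) (by rw [dom_bij]; exact hA)
  have e : (bij A 1).pe = bij A 1 := by
    ext i j
    · rfl
    · simp only [pe, dom_bij]
      simp only [bij, Equiv.Perm.one_apply]
      tauto
    · rfl
  rwa [e] at this

theorem starD (H : Hyp n r P) (d : PD n) (h : d.D ∈ P) : d.star.D ∈ P := by
  rw [star_D]; exact H.star _ h

/-- one hook, identity on `A` -/
def hk (A : Set (Fin n)) (x y : Fin n) : PD n where
  U i j := x ≠ y ∧ x ∉ A ∧ y ∉ A ∧ ((i = x ∧ j = y) ∨ (i = y ∧ j = x))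
  T i j := i = j ∧ i ∈ A
  L _ _ := False
  Usym := by grind
  Uirr := by grind
  Uun := by grind
  Lsym := by simp
  Lirr := by simp
  Lun := by simp
  Tl := by grind
  Tr := by grind
  UT := by grind
  LT := by simp

theorem dom_hk (A : Set (Fin n)) (x y : Fin n) : (hk A x y).dom = A := by
  ext i; simp [dom, hk]

theorem hk_mem (H : Hyp n r P) (A : Set (Fin n)) (hA : A.ncard = r) (x y : Fin n) :
    (hk A x y).D ∈ P := by
  have h1 := H.h1 (hk A x y) (by rw [dom_hk]; exact hA)
  have h2 := H.mul _ _ h1 (H.bij_one A hA)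
  have e : (hk A x y).mid = bij A 1 := by
    ext i j
    · rfl
    · simp only [mid, hk, bij, Equiv.Perm.one_apply]
      tauto
    · rfl
  rw [← e, eq_pe_mid] at h2
  exact h2

theorem move (H : Hyp n r P) (A : Set (Fin n)) (hA : A.ncard = r) (i k : Fin n)
    (hi : i ∈ A) (hk' : k ∉ A) : (bij A (Equiv.swap i k)).D ∈ P := by
  obtain ⟨j, hj⟩ := exists_not_mem (insert k A) (by
    have := Set.ncard_insert_le k A
    have := H.hr
    omega)
  have hjk : j ≠ k := fun h => hj (by simp [h])
  have hjA : j ∉ A := fun h => hj (by simp [h])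
  have hik : i ≠ k := fun h => hk' (h ▸ hi)
  have hij : i ≠ j := fun h => hjA (h ▸ hi)
  set A' : Set (Fin n) := insert k (A \ {i}) with hA'
  have hA'c : A'.ncard = r := by
    rw [hA', Set.ncard_exchange hk' hi, hA]
  have hp := H.starD _ (H.hk_mem A hA j k)
  have hq := H.hk_mem A' hA'c i j
  have := H.mul _ _ hp hq
  convert this using 1
  symm
  have hT : ∀ a b, a ∈ A → Equiv.swap i k a = b →
      (pmul (hk A j k).star.D (hk A' i j).D).r (Sum.inl a) (Sum.inr b) := by
    intro a b ha hab
    have e1 : ∀ a ∈ A, RGen (prodEdges (hk A j k).star.D (hk A' i j).D) (Sum.inl a)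
        (Sum.inr (Sum.inl a)) := fun a ha =>
      RGen.rel (Or.inl ⟨Sum.inl a, Sum.inr a, ⟨rfl, ha⟩, rfl, rfl⟩)
    have e2 : ∀ a ∈ A', RGen (prodEdges (hk A j k).star.D (hk A' i j).D) (Sum.inr (Sum.inl a))
        (Sum.inr (Sum.inr a)) := fun a ha =>
      RGen.rel (Or.inr ⟨Sum.inl a, Sum.inr a, ⟨rfl, ha⟩, rfl, rfl⟩)
    by_cases hai : a = i
    · subst hai
      rw [Equiv.swap_apply_left] at hab
      subst hab
      have e3 : RGen (prodEdges (hk A j k).star.D (hk A' a j).D) (Sum.inr (Sum.inl a))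
          (Sum.inr (Sum.inl j)) :=
        RGen.rel (Or.inr ⟨Sum.inl a, Sum.inl j,
          Or.inr ⟨hij, by simp [hA', hik], by simp [hA', hjk, hjA], Or.inl ⟨rfl, rfl⟩⟩, rfl, rfl⟩)
      have e4 : RGen (prodEdges (hk A j k).star.D (hk A' a j).D) (Sum.inr (Sum.inl j))
          (Sum.inr (Sum.inl k)) :=
        RGen.rel (Or.inl ⟨Sum.inr j, Sum.inr k,
          Or.inr ⟨hjk, hjA, hk', Or.inl ⟨rfl, rfl⟩⟩, rfl, rfl⟩)
      exact (((e1 _ ha).trans e3).trans e4).trans (e2 _ (by simp [hA']))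
    · have hak : a ≠ k := fun h => hk' (h ▸ ha)
      rw [Equiv.swap_apply_of_ne_of_ne hai hak] at hab
      subst hab
      exact (e1 _ ha).trans (e2 _ (by simp [hA', ha, hai]))
  refine pmul_eq_of (isPB _) (isPB _) ?_ ?_
  · rintro (a | a) (b | b) h
    · rcases h with h | h
      · rw [h]
      · exact h.elim
    · exact hT _ _ h.1 h.2
    · exact (hT _ _ h.1 h.2).symm
    · rcases h with h | h
      · rw [h]
      · exact h.elim
  · rintro (a | a) h
    · refine pmul_upsing ?_
      have haA : a ∉ A := by
        intro ha
        have := h (Sum.inr (Equiv.swap i k a)) ⟨ha, rfl⟩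
        simp at this
      rintro (b | b) hb
      · rcases hb with hb | hb
        · rw [hb]
        · exact hb.elim
      · obtain ⟨rfl, hb⟩ := hb
        exact absurd hb haA
    · refine pmul_losing ?_
      have haA : a ∉ A' := by
        rintro (ha | ⟨ha, hai⟩)
        · have := h (Sum.inl i) ⟨hi, by rw [ha]; simp⟩
          simp at this
        · have hak : a ≠ k := fun h => hk' (h ▸ ha)
          have := h (Sum.inl a) ⟨ha, Equiv.swap_apply_of_ne_of_ne hai hak⟩
          simp at this
      rintro (b | b) hb
      · obtain ⟨rfl, hb⟩ := hb
        exact absurd hb haA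
      · rcases hb with hb | hb
        · rw [hb]
        · exact hb.elim

theorem comp (H : Hyp n r P) (A : Set (Fin n)) (σ τ : Equiv.Perm (Fin n))
    (h1 : (bij A σ).D ∈ P) (h2 : (bij (σ '' A) τ).D ∈ P) : (bij A (τ * σ)).D ∈ P := by
  have := H.mul _ _ h1 h2
  rwa [mul_simple (bij A σ) (bij (σ '' A) τ) (bij A (τ * σ)) (fun _ _ h => h) (fun _ _ => Iff.rfl) (by
    intro i j
    constructor
    · rintro ⟨h, rfl⟩; exact ⟨σ i, ⟨h, rfl⟩, ⟨i, h, rfl⟩, rfl⟩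
    · rintro ⟨k, ⟨h, rfl⟩, _, rfl⟩; exact ⟨h, rfl⟩) (by
    intro i j
    constructor
    · intro h; exact h.elim
    · rintro (h | ⟨_, _, h, _⟩)
      · exact h
      · exact h.elim)] at this

theorem bij_congr (A : Set (Fin n)) (σ τ : Equiv.Perm (Fin n)) (h : ∀ i ∈ A, σ i = τ i) :
    bij A σ = bij A τ := by
  ext i j
  · rfl
  · simp only [bij]
    constructor
    · rintro ⟨h1, h2⟩; exact ⟨h1, by rw [← h i h1, h2]⟩
    · rintro ⟨h1, h2⟩; exact ⟨h1, by rw [h i h1, h2]⟩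
  · rfl

theorem image_card (A : Set (Fin n)) (σ : Equiv.Perm (Fin n)) : (σ '' A).ncard = A.ncard :=
  Set.ncard_image_of_injective _ σ.injective

theorem bij_swap (H : Hyp n r P) (A : Set (Fin n)) (hA : A.ncard = r) (i k : Fin n) :
    (bij A (Equiv.swap i k)).D ∈ P := by
  by_cases hi : i ∈ A <;> by_cases hk' : k ∈ A
  · by_cases hik : i = k
    · subst hik
      rw [Equiv.swap_self]
      exact H.bij_one A hA
    obtain ⟨x, hx⟩ := exists_not_mem A (by have := H.hr; omega)
    have hxi : x ≠ i := fun h => hx (h ▸ hi)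
    have hxk : x ≠ k := fun h => hx (h ▸ hk')
    -- i → x, then k → i, then x → k
    have h1 := H.move A hA i x hi hx
    have h2 := H.move (Equiv.swap i x '' A) (by rw [image_card, hA]) k i
      ⟨k, hk', Equiv.swap_apply_of_ne_of_ne (Ne.symm hik) (Ne.symm hxk)⟩ (by
        rintro ⟨a, ha, ha'⟩
        have : a = Equiv.swap i x i := (Equiv.swap_apply_self i x a).symm.trans (congrArg _ ha')
        rw [Equiv.swap_apply_left] at this
        exact hx (this ▸ ha))
    have h12 := H.comp _ _ _ h1 h2
    have h3 := H.move ((Equiv.swap k i * Equiv.swap i x) '' A) (by rw [image_card, hA]) x k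
      ⟨i, hi, by
        rw [Equiv.Perm.mul_apply, Equiv.swap_apply_left, Equiv.swap_apply_of_ne_of_ne hxk hxi]⟩ (by
        rintro ⟨a, ha, ha'⟩
        rw [Equiv.Perm.mul_apply] at ha'
        have : Equiv.swap i x a = i := by
          apply (Equiv.swap k i).injective
          rw [ha', Equiv.swap_apply_right]
        have : a = Equiv.swap i x i := (Equiv.swap_apply_self i x a).symm.trans (congrArg _ this)
        rw [Equiv.swap_apply_left] at this
        exact hx (this ▸ ha))
    have h123 := H.comp _ _ _ h12 h3
    rw [bij_congr A _ (Equiv.swap i k)] at h123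
    · exact h123
    · intro a ha
      have hax : a ≠ x := fun h => hx (h ▸ ha)
      simp only [Equiv.Perm.mul_apply]
      simp only [Equiv.swap_apply_def]
      grind
  · exact H.move A hA i k hi hk'
  · rw [Equiv.swap_comm]
    exact H.move A hA k i hk' hi
  · rw [bij_congr A _ 1]
    · exact H.bij_one A hA
    · intro a ha
      rw [Equiv.swap_apply_of_ne_of_ne, Equiv.Perm.one_apply]
      · rintro rfl; exact hi ha
      · rintro rfl; exact hk' ha

theorem bij_mem (H : Hyp n r P) (A : Set (Fin n)) (hA : A.ncard = r) (σ : Equiv.Perm (Fin n)) :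
    (bij A σ).D ∈ P := by
  induction σ using Equiv.Perm.swap_induction_on with
  | one => exact H.bij_one A hA
  | swap_mul f x y _ ih =>
    exact H.comp _ _ _ ih (H.bij_swap _ (by rw [image_card, hA]) x y)

theorem of_lowS (H : Hyp n r P) (s : ℕ) (h : ∀ d : PD n, d.dom.ncard = s → d.lowS.D ∈ P)
    (d : PD n) (hd : d.dom.ncard = s) : d.D ∈ P := by
  rw [← eq_low_up]
  refine H.mul _ _ (h d hd) (H.starD _ (h _ ?_))
  rw [dom_pe, dom_star, ncard_cod, hd]

theorem full (H : Hyp n r P) (d : PD n) (hd : d.dom.ncard = r) : d.D ∈ P := by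
  refine H.of_lowS r ?_ d hd
  intro d hd
  rw [← eq_pe_mid]
  refine H.mul _ _ (H.h1 d hd) ?_
  obtain ⟨σ, hσ⟩ := d.mid_eq_bij
  rw [hσ]
  exact H.bij_mem _ hd σ

/-- add a transversal -/
def addT (d : PD n) (x y : Fin n) (hxU : ∀ j, ¬ d.U x j) (hxT : ∀ j, ¬ d.T x j)
    (hyL : ∀ j, ¬ d.L y j) (hyT : ∀ j, ¬ d.T j y) : PD n where
  U := d.U
  T i j := d.T i j ∨ (i = x ∧ j = y)
  L := d.L
  Usym := d.Usym
  Uirr := d.Uirr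
  Uun := d.Uun
  Lsym := d.Lsym
  Lirr := d.Lirr
  Lun := d.Lun
  Tl := by have := d.Tl; grind
  Tr := by have := d.Tr; grind
  UT := by have := d.UT; grind
  LT := by have := d.LT; grind

def gam (d : PD n) (w y : Fin n) (hw : ∀ j, ¬ d.T j w)
    (hyL : ∀ j, ¬ d.L y j) (hyT : ∀ j, ¬ d.T j y) : PD n where
  U _ _ := False
  T i j := (i = j ∧ i ∈ d.cod) ∨ (i = w ∧ j = y)
  L := d.L
  Usym := by simp
  Uirr := by simp
  Uun := by simp
  Lsym := d.Lsym
  Lirr := d.Lirr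
  Lun := d.Lun
  Tl := by
    rintro i j k (⟨rfl, a, ha⟩ | ⟨rfl, rfl⟩) (⟨rfl, b, hb⟩ | ⟨h, rfl⟩) <;> grind
  Tr := by
    rintro i j k (⟨rfl, a, ha⟩ | ⟨rfl, rfl⟩) (⟨rfl, b, hb⟩ | ⟨h, h'⟩) <;> grind
  UT := by simp
  LT := by
    rintro i j k h (⟨rfl, a, ha⟩ | ⟨rfl, rfl⟩)
    · exact d.LT _ _ _ h ha
    · exact hyL _ h

theorem caseA (H : Hyp n r P) (s : ℕ) (hs : s < r)
    (IH : ∀ d : PD n, d.dom.ncard = s + 1 → d.D ∈ P) (d : PD n) (hd : d.dom.ncard = s)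
    (x y : Fin n) (hxU : ∀ j, ¬ d.U x j) (hxT : x ∉ d.dom)
    (hyL : ∀ j, ¬ d.L y j) (hyT : y ∉ d.cod) : d.D ∈ P := by
  have hxT' : ∀ j, ¬ d.T x j := fun j h => hxT ⟨j, h⟩
  have hyT' : ∀ j, ¬ d.T j y := fun j h => hyT ⟨j, h⟩
  obtain ⟨w, hw⟩ := exists_not_mem (insert y d.cod) (by
    have := Set.ncard_insert_le y d.cod
    have := H.hr
    rw [ncard_cod] at *
    omega)
  have hwy : w ≠ y := fun h => hw (by simp [h])
  have hwT : ∀ j, ¬ d.T j w := fun j h => hw (Or.inr ⟨j, h⟩)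
  have h1 := IH (addT d x y hxU hxT' hyL hyT') (by
    have : (addT d x y hxU hxT' hyL hyT').dom = insert x d.dom := by
      ext i
      constructor
      · rintro ⟨j, h | ⟨rfl, rfl⟩⟩
        · exact Or.inr ⟨j, h⟩
        · exact Or.inl rfl
      · rintro (rfl | ⟨j, h⟩)
        · exact ⟨y, Or.inr ⟨rfl, rfl⟩⟩
        · exact ⟨j, Or.inl h⟩
    rw [this, Set.ncard_insert_of_notMem hxT, hd])
  have h2 := IH (gam d w y hwT hyL hyT') (by
    have : (gam d w y hwT hyL hyT').dom = insert w d.cod := by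
      ext i
      constructor
      · rintro ⟨j, ⟨_, h⟩ | ⟨rfl, rfl⟩⟩
        · exact Or.inr h
        · exact Or.inl rfl
      · rintro (rfl | h)
        · exact ⟨y, Or.inr ⟨rfl, rfl⟩⟩
        · exact ⟨i, Or.inl ⟨rfl, h⟩⟩
    rw [this, Set.ncard_insert_of_notMem (fun h => hw (Or.inr h)), ncard_cod, hd])
  have := H.mul _ _ h1 h2
  rwa [mul_simple (addT d x y hxU hxT' hyL hyT') (gam d w y hwT hyL hyT') d (fun _ _ h => h) (fun _ _ => Iff.rfl) (by
    intro i j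
    constructor
    · intro h
      exact ⟨j, Or.inl h, Or.inl ⟨rfl, i, h⟩⟩
    · rintro ⟨k, h | ⟨rfl, rfl⟩, ⟨rfl, h'⟩ | ⟨rfl, rfl⟩⟩
      · exact h
      · exact absurd h (hwT _)
      · exact absurd h' hyT
      · exact absurd rfl hwy) (by
    intro i j
    constructor
    · intro h; exact Or.inl h
    · rintro (h | ⟨k, l, h, ⟨rfl, a, h'⟩ | ⟨rfl, rfl⟩, h''⟩)
      · exact h
      · exact absurd h' (d.LT _ _ _ h)
      · rcases h'' with ⟨rfl, a, h''⟩ | ⟨rfl, rfl⟩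
        · exact absurd h'' (d.LT _ _ _ (d.Lsym _ _ h))
        · exact absurd h (d.Lirr _))] at this

/-- replace a hook by two transversals, keep upper half -/
def bet (d : PD n) (x y : Fin n) (h : d.U x y) : PD n where
  U i j := d.U i j ∧ i ≠ x ∧ i ≠ y
  T i j := i = j ∧ (i ∈ d.dom ∨ i = x ∨ i = y)
  L _ _ := False
  Usym := by have := d.Usym; have := d.Uun; grind
  Uirr := by have := d.Uirr; grind
  Uun := by have := d.Uun; grind
  Lsym := by simp
  Lirr := by simp
  Lun := by simp
  Tl := by grind
  Tr := by grind
  UT := by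
    rintro i j k ⟨h1, h2, h3⟩ ⟨rfl, ⟨l, hl⟩ | h | h⟩
    · exact d.UT _ _ _ h1 hl
    · exact h2 h
    · exact h3 h
  LT := by simp

def gam2 (d : PD n) (x y : Fin n) (h : d.U x y) : PD n where
  U i j := (i = x ∧ j = y) ∨ (i = y ∧ j = x)
  T := d.T
  L _ _ := False
  Usym := by grind
  Uirr := by have := d.Uirr; grind
  Uun := by have := d.Uirr; grind
  Lsym := by simp
  Lirr := by simp
  Lun := by simp
  Tl := d.Tl
  Tr := d.Tr
  UT := by have := d.UT; have := d.Usym; grind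
  LT := by simp

theorem all (H : Hyp n r P) : ∀ (k : ℕ) (d : PD n), d.dom.ncard + k = r → d.D ∈ P := by
  intro k
  induction k using Nat.strong_induction_on with
  | _ k ih =>
  rcases k with _ | k
  · exact H.full
  intro d hd
  obtain ⟨s, hs⟩ : ∃ s, s = d.dom.ncard := ⟨_, rfl⟩
  have hsk : s + (k + 1) = r := by rw [hs]; exact hd
  have IH : ∀ d : PD n, d.dom.ncard = s + 1 → d.D ∈ P := fun d hd => ih k (by omega) d (by omega)
  refine H.of_lowS s ?_ d hs.symm
  clear hd hs d
  intro d hd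
  have hr := H.hr
  obtain ⟨y, hy⟩ := exists_not_mem d.cod (by rw [ncard_cod]; omega)
  by_cases hx : ∃ x, x ∉ d.dom ∧ ∀ j, ¬ d.U x j
  · obtain ⟨x, hx1, hx2⟩ := hx
    exact H.caseA s (by omega) IH d.lowS hd x y hx2 hx1 (fun _ h => h) hy
  push Not at hx
  obtain ⟨x, hxd⟩ := exists_not_mem d.dom (by omega)
  by_cases hk0 : k = 0
  · subst hk0
    rw [← eq_pe_mid]
    refine H.mul _ _ (H.h2 d (by omega) fun i => ?_) ?_
    · by_cases hi : i ∈ d.dom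
      · exact Or.inl hi
      · exact Or.inr (hx i hi)
    · exact H.caseA s (by omega) IH d.mid hd x y (fun _ h => h) hxd (fun _ h => h) hy
  · obtain ⟨y', hxy⟩ := hx x hxd
    have hyd : y' ∉ d.dom := fun ⟨l, hl⟩ => d.UT _ _ _ (d.Usym _ _ hxy) hl
    have hne : x ≠ y' := by rintro rfl; exact d.Uirr _ hxy
    have hcard : (insert x (insert y' d.dom)).ncard = s + 2 := by
      rw [Set.ncard_insert_of_notMem, Set.ncard_insert_of_notMem hyd, hd]
      simp [hne, hxd]
    have hb := ih (k - 1) (by omega) (bet d x y' hxy) (by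
      have : (bet d x y' hxy).dom = insert x (insert y' d.dom) := by
        ext i
        constructor
        · rintro ⟨j, rfl, h⟩; simp; tauto
        · intro h; refine ⟨i, rfl, ?_⟩; simp at h; tauto
      rw [this, hcard]; omega)
    obtain ⟨z, hz⟩ := exists_not_mem (insert x (insert y' d.dom)) (by omega)
    simp only [Set.mem_insert_iff, not_or] at hz
    have hg := H.caseA s (by omega) IH (gam2 d x y' hxy) hd z y (by
      rintro j (⟨h, _⟩ | ⟨h, _⟩)
      · exact hz.1 h
      · exact hz.2.1 h) hz.2.2 (fun _ h => h) hy
    have := H.mul _ _ hb hg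
    rwa [mul_simple' (bet d x y' hxy) (gam2 d x y' hxy) d.lowS (fun _ _ h => h) (fun _ _ => Iff.rfl) (by
      intro i j
      constructor
      · intro h; exact ⟨i, ⟨rfl, Or.inl ⟨j, h⟩⟩, h⟩
      · rintro ⟨k, ⟨rfl, _⟩, h⟩; exact h) (by
      intro i j
      constructor
      · intro h
        change d.U i j at h
        by_cases h1 : i = x
        · subst h1
          have := d.Uun _ _ _ h hxy
          subst this
          exact Or.inr ⟨i, j, Or.inl ⟨rfl, rfl⟩, ⟨rfl, by simp⟩, ⟨rfl, by simp⟩⟩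
        · by_cases h2 : i = y'
          · subst h2
            have := d.Uun _ _ _ h (d.Usym _ _ hxy)
            subst this
            exact Or.inr ⟨i, j, Or.inr ⟨rfl, rfl⟩, ⟨rfl, by simp⟩, ⟨rfl, by simp⟩⟩
          · exact Or.inl ⟨h, h1, h2⟩
      · rintro (h | ⟨k, l, ⟨rfl, rfl⟩ | ⟨rfl, rfl⟩, ⟨rfl, _⟩, ⟨rfl, _⟩⟩)
        · exact h.1
        · exact hxy
        · exact d.Usym _ _ hxy)] at this

end Hyp

end PBR
/-! ### Counting -/

namespace PBR

section count
variable {n : ℕ}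

def invs (S : Finset (Fin n)) : Finset (Equiv.Perm (Fin n)) :=
  Finset.univ.filter fun f => f * f = 1 ∧ f.support ⊆ S

def pfs (S : Finset (Fin n)) : Finset (Equiv.Perm (Fin n)) :=
  Finset.univ.filter fun f => f * f = 1 ∧ f.support = S

theorem sw_inv {x y : Fin n} {f : Equiv.Perm (Fin n)} (hf : f * f = 1)
    (h : Equiv.swap (f x) (f y) = Equiv.swap x y) :
    (Equiv.swap x y * f) * (Equiv.swap x y * f) = 1 := by
  have hi : f⁻¹ = f := inv_eq_of_mul_eq_one_left hf
  have : f * Equiv.swap x y * f⁻¹ = Equiv.swap x y :=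
    (Equiv.swap_apply_apply f x y).symm.trans h
  rw [hi] at this
  calc (Equiv.swap x y * f) * (Equiv.swap x y * f)
      = Equiv.swap x y * (f * Equiv.swap x y * f) := by simp only [mul_assoc]
    _ = 1 := by rw [this, Equiv.swap_mul_self]

theorem sw_support {x y : Fin n} (hxy : x ≠ y) {g : Equiv.Perm (Fin n)} (hx : g x = x)
    (hy : g y = y) (z : Fin n) :
    z ∈ (Equiv.swap x y * g).support ↔ z = x ∨ z = y ∨ z ∈ g.support := by
  simp only [Equiv.Perm.mem_support, Equiv.Perm.mul_apply]
  by_cases h1 : z = x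
  · subst h1; simp [hx, hxy.symm]
  by_cases h2 : z = y
  · subst h2; simp [hy, hxy]
  have h3 : g z ≠ x := fun h => h1 (g.injective (h.trans hx.symm))
  have h4 : g z ≠ y := fun h => h2 (g.injective (h.trans hy.symm))
  rw [Equiv.swap_apply_of_ne_of_ne h3 h4]
  simp [h1, h2]

theorem inv_symm {f : Equiv.Perm (Fin n)} (hf : f * f = 1) (z : Fin n) : f (f z) = z := by
  rw [← Equiv.Perm.mul_apply, hf, Equiv.Perm.one_apply]

theorem fiber_card (Q R : Equiv.Perm (Fin n) → Prop) {x y : Fin n} (hxy : x ≠ y)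
    [DecidablePred fun f : Equiv.Perm (Fin n) => (f * f = 1 ∧ Q f) ∧ f x = y]
    [DecidablePred fun g : Equiv.Perm (Fin n) => g * g = 1 ∧ R g]
    (hR : ∀ g, R g → g x = x ∧ g y = y)
    (hQR : ∀ g : Equiv.Perm (Fin n), g x = x → g y = y → (Q (Equiv.swap x y * g) ↔ R g)) :
    (Finset.univ.filter fun f : Equiv.Perm (Fin n) => (f * f = 1 ∧ Q f) ∧ f x = y).card =
    (Finset.univ.filter fun g : Equiv.Perm (Fin n) => g * g = 1 ∧ R g).card := by
  have hss : ∀ f : Equiv.Perm (Fin n), Equiv.swap x y * (Equiv.swap x y * f) = f := by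
    intro f; rw [← mul_assoc, Equiv.swap_mul_self, one_mul]
  refine Finset.card_bij' (fun f _ => Equiv.swap x y * f) (fun f _ => Equiv.swap x y * f)
    ?_ ?_ ?_ ?_
  · intro f hf
    simp only [Finset.mem_filter, Finset.mem_univ, true_and] at hf ⊢
    obtain ⟨⟨h1, h2⟩, h3⟩ := hf
    have h4 : f y = x := by rw [← h3, inv_symm h1]
    refine ⟨sw_inv h1 (by rw [h3, h4, Equiv.swap_comm]), ?_⟩
    rw [← hQR, hss]
    · exact h2
    · simp [h3]
    · simp [h4]
  · intro g hg
    simp only [Finset.mem_filter, Finset.mem_univ, true_and] at hg ⊢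
    obtain ⟨h1, h2⟩ := hg
    obtain ⟨hx, hy⟩ := hR g h2
    refine ⟨⟨sw_inv h1 (by rw [hx, hy]), (hQR g hx hy).2 h2⟩, by simp [hx]⟩
  · intro f _; exact hss f
  · intro f _; exact hss f

theorem maps_S {S : Finset (Fin n)} {x : Fin n} (hx : x ∈ S) {f : Equiv.Perm (Fin n)}
    (hs : f.support ⊆ S) : f x ∈ S := by
  by_cases h : f x = x
  · rwa [h]
  · exact hs (by simpa using h)

theorem invs_fiber {S : Finset (Fin n)} {x y : Fin n} (hx : x ∈ S) (hy : y ∈ S) (hxy : x ≠ y) :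
    ((invs S).filter fun f => f x = y).card = (invs ((S.erase x).erase y)).card := by
  unfold invs
  rw [Finset.filter_filter]
  refine fiber_card (fun f => f.support ⊆ S) (fun f => f.support ⊆ (S.erase x).erase y) hxy ?_ ?_
  · intro g hg
    constructor
    · by_contra h
      have := hg (Equiv.Perm.mem_support.2 h)
      simp at this
    · by_contra h
      have := hg (Equiv.Perm.mem_support.2 h)
      simp at this
  · intro g h1 h2
    simp only [Finset.subset_iff, sw_support hxy h1 h2, Finset.mem_erase]
    constructor
    · intro h z hz
      refine ⟨?_, ?_, h (Or.inr (Or.inr hz))⟩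
      · rintro rfl; simp [h2] at hz
      · rintro rfl; simp [h1] at hz
    · rintro h z (rfl | rfl | hz)
      · exact hx
      · exact hy
      · exact (h hz).2.2

theorem pfs_fiber {S : Finset (Fin n)} {x y : Fin n} (hx : x ∈ S) (hy : y ∈ S) (hxy : x ≠ y) :
    ((pfs S).filter fun f => f x = y).card = (pfs ((S.erase x).erase y)).card := by
  unfold pfs
  rw [Finset.filter_filter]
  refine fiber_card (fun f => f.support = S) (fun f => f.support = (S.erase x).erase y) hxy ?_ ?_
  · intro g hg
    constructor
    · by_contra h
      have := hg ▸ (Equiv.Perm.mem_support.2 h)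
      simp at this
    · by_contra h
      have := hg ▸ (Equiv.Perm.mem_support.2 h)
      simp at this
  · intro g h1 h2
    simp only [Finset.ext_iff, sw_support hxy h1 h2, Finset.mem_erase]
    have e1 : x ∉ g.support := by simp [h1]
    have e2 : y ∉ g.support := by simp [h2]
    constructor
    · intro h z
      have := h z
      grind
    · intro h z
      have := h z
      grind

theorem card_invs (m : ℕ) : ∀ S : Finset (Fin n), S.card = m → (invs S).card = aSeq m := by
  induction m using Nat.strong_induction_on with
  | _ m ih =>
  intro S hS
  by_cases hm : m = 0
  · subst hm
    rw [Finset.card_eq_zero] at hS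
    subst hS
    have : invs (∅ : Finset (Fin n)) = {1} := by
      ext f
      simp only [invs, Finset.mem_filter, Finset.mem_univ, true_and, Finset.subset_empty,
        Equiv.Perm.support_eq_empty_iff, Finset.mem_singleton]
      constructor
      · exact fun h => h.2
      · rintro rfl; simp
    rw [this]; rfl
  obtain ⟨x, hx⟩ : S.Nonempty := by rw [← Finset.card_pos]; omega
  have hmaps : ∀ f ∈ invs S, f x ∈ S := by
    intro f hf
    simp only [invs, Finset.mem_filter] at hf
    exact maps_S hx hf.2.2
  rw [Finset.card_eq_sum_card_fiberwise hmaps, ← Finset.add_sum_erase _ _ hx]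
  have h1 : ((invs S).filter fun f => f x = x).card = aSeq (m - 1) := by
    rw [← ih (m - 1) (by omega) (S.erase x) (by rw [Finset.card_erase_of_mem hx, hS])]
    congr 1
    ext f
    simp only [invs, Finset.mem_filter, Finset.mem_univ, true_and, Finset.subset_erase,
      Equiv.Perm.mem_support, not_not, and_assoc]
  have h2 : ∀ y ∈ S.erase x, ((invs S).filter fun f => f x = y).card = aSeq (m - 2) := by
    intro y hy
    rw [Finset.mem_erase] at hy
    rw [invs_fiber hx hy.2 hy.1.symm]
    refine ih (m - 2) (by omega) _ ?_
    rw [Finset.card_erase_of_mem (by simp [hy]), Finset.card_erase_of_mem hx, hS]; omega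
  rw [h1, Finset.sum_congr rfl h2, Finset.sum_const, Finset.card_erase_of_mem hx, hS, smul_eq_mul]
  rcases m with _ | _ | m
  · exact absurd rfl hm
  · simp [aSeq]
  · simp [aSeq]

theorem card_pfs (m : ℕ) : ∀ S : Finset (Fin n), S.card = m + 1 → (pfs S).card = oddDF m := by
  induction m using Nat.strong_induction_on with
  | _ m ih =>
  intro S hS
  obtain ⟨x, hx⟩ : S.Nonempty := by rw [← Finset.card_pos]; omega
  have hmaps : ∀ f ∈ pfs S, f x ∈ S := by
    intro f hf
    simp only [pfs, Finset.mem_filter] at hf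
    exact maps_S hx hf.2.2.subset
  rw [Finset.card_eq_sum_card_fiberwise hmaps, ← Finset.add_sum_erase _ _ hx]
  have h1 : ((pfs S).filter fun f => f x = x).card = 0 := by
    rw [Finset.card_eq_zero, Finset.filter_eq_empty_iff]
    intro f hf h
    simp only [pfs, Finset.mem_filter] at hf
    rw [← hf.2.2] at hx
    exact Equiv.Perm.mem_support.1 hx h
  have hc : ∀ y ∈ S.erase x, ((S.erase x).erase y).card = m - 1 := by
    intro y hy
    rw [Finset.card_erase_of_mem hy, Finset.card_erase_of_mem hx, hS]; omega
  have h2 : ∀ y ∈ S.erase x, ((pfs S).filter fun f => f x = y).card =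
      if m = 1 then 1 else oddDF (m - 2) := by
    intro y hy
    have hy' := hy
    rw [Finset.mem_erase] at hy
    rw [pfs_fiber hx hy.2 hy.1.symm]
    have hm0 : m ≠ 0 := by
      rintro rfl
      have := Finset.card_pos.2 ⟨y, hy'⟩
      rw [Finset.card_erase_of_mem hx, hS] at this
      omega
    split_ifs with hm
    · have := hc y hy'
      rw [hm, Nat.sub_self, Finset.card_eq_zero] at this
      rw [this]
      have : pfs (∅ : Finset (Fin n)) = {1} := by
        ext f
        simp only [pfs, Finset.mem_filter, Finset.mem_univ, true_and,
          Equiv.Perm.support_eq_empty_iff, Finset.mem_singleton]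
        constructor
        · exact fun h => h.2
        · rintro rfl; simp
      rw [this]; rfl
    · refine ih (m - 2) (by omega) _ ?_
      rw [hc y hy']; omega
  rw [h1, Finset.sum_congr rfl h2, Finset.sum_const, Finset.card_erase_of_mem hx, hS, smul_eq_mul]
  rcases m with _ | _ | m
  · simp [oddDF]
  · simp [oddDF]
  · simp [oddDF]

abbrev Pat (n : ℕ) := Finset (Fin n) × Equiv.Perm (Fin n)

def PS1 (n r : ℕ) : Finset (Pat n) :=
  Finset.univ.filter fun p => p.1.card = r ∧ p.2 * p.2 = 1 ∧ p.2.support ⊆ p.1ᶜ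

def PS2 (n r : ℕ) : Finset (Pat n) :=
  Finset.univ.filter fun p => p.1.card + 1 = r ∧ p.2 * p.2 = 1 ∧ p.2.support = p.1ᶜ

theorem card_fib (r c : ℕ) (s : Finset (Pat n)) (t : Finset (Fin n) → Finset (Equiv.Perm (Fin n)))
    (hs : ∀ p, p ∈ s ↔ p.1.card = r ∧ p.2 ∈ t p.1) (ht : ∀ A : Finset (Fin n), A.card = r → (t A).card = c) :
    s.card = n.choose r * c := by
  have hmaps : ∀ p ∈ s, p.1 ∈ Finset.powersetCard r (Finset.univ : Finset (Fin n)) := by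
    intro p hp
    rw [Finset.mem_powersetCard]
    exact ⟨Finset.subset_univ _, ((hs p).1 hp).1⟩
  rw [Finset.card_eq_sum_card_fiberwise hmaps]
  have : ∀ A ∈ Finset.powersetCard r (Finset.univ : Finset (Fin n)),
      (s.filter fun p => p.1 = A).card = c := by
    intro A hA
    rw [Finset.mem_powersetCard] at hA
    rw [← ht A hA.2]
    refine Finset.card_bij' (fun p _ => p.2) (fun f _ => (A, f)) ?_ ?_ ?_ ?_
    · intro p hp
      simp only [Finset.mem_filter, hs] at hp
      obtain ⟨⟨_, h⟩, rfl⟩ := hp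
      exact h
    · intro f hf
      simp only [Finset.mem_filter, hs]
      exact ⟨⟨hA.2, hf⟩, trivial⟩
    · rintro ⟨B, f⟩ hp
      simp only [Finset.mem_filter] at hp
      simp [hp.2]
    · intro f hf; rfl
  rw [Finset.sum_congr rfl this, Finset.sum_const, Finset.card_powersetCard, Finset.card_univ,
    Fintype.card_fin, smul_eq_mul]

theorem card_PS1 (r : ℕ) : (PS1 n r).card = n.choose r * aSeq (n - r) := by
  refine card_fib r _ _ (fun A => invs Aᶜ) ?_ ?_
  · intro p; simp [PS1, invs]
  · intro A hA
    exact card_invs _ _ (by rw [Finset.card_compl, hA, Fintype.card_fin])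

theorem card_PS2 (r : ℕ) (h : r + 2 ≤ n) :
    (PS2 n r).card = if r = 0 then 0 else n.choose (r - 1) * oddDF (n - r) := by
  split_ifs with hr
  · rw [Finset.card_eq_zero, PS2, Finset.filter_eq_empty_iff]
    rintro p _ ⟨h, _⟩
    omega
  · refine card_fib (r - 1) _ _ (fun A => pfs Aᶜ) ?_ ?_
    · intro p
      simp only [PS2, pfs, Finset.mem_filter, Finset.mem_univ, true_and]
      have : p.1.card + 1 = r ↔ p.1.card = r - 1 := by omega
      rw [this]
    · intro A hA
      refine card_pfs _ _ ?_
      rw [Finset.card_compl, hA, Fintype.card_fin]; omega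

def PS (n r : ℕ) : Finset (Pat n) := PS2 n r ∪ PS1 n r

theorem card_PS (r : ℕ) (h : r + 2 ≤ n) : (PS n r).card =
    (if r = 0 then 0 else n.choose (r - 1) * oddDF (n - r)) + n.choose r * aSeq (n - r) := by
  rw [PS, Finset.card_union_of_disjoint, card_PS1, card_PS2 r h]
  rw [Finset.disjoint_left]
  intro p h1 h2
  simp only [PS1, PS2, Finset.mem_filter] at h1 h2
  omega

theorem mem_PS {r : ℕ} {p : Pat n} (hp : p ∈ PS n r) : p.2 * p.2 = 1 ∧ p.2.support ⊆ p.1ᶜ ∧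
    (p.1.card = r ∨ (p.1.card + 1 = r ∧ p.2.support = p.1ᶜ)) := by
  simp only [PS, Finset.mem_union, PS1, PS2, Finset.mem_filter] at hp
  rcases hp with ⟨_, h1, h2, h3⟩ | ⟨_, h1, h2, h3⟩
  · exact ⟨h2, h3.subset, Or.inr ⟨h1, h3⟩⟩
  · exact ⟨h2, h3, Or.inl h1⟩

end count

/-! ### Assembly -/

variable {n : ℕ}
open PD

def X0 (n r : ℕ) : Finset (Dgm n) := (PS n r).image fun p => (prj p.1 p.2).D

def tp (α : Dgm n) : Set (Fin n) × (Fin n → Fin n → Prop) :=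
  (domSet α, fun i j => α.r (Sum.inl i) (Sum.inl j))

theorem dom_prj (A : Finset (Fin n)) (f : Equiv.Perm (Fin n)) : (prj A f).dom = ↑A := by
  ext i; simp [dom, prj]

theorem prj_U {A : Finset (Fin n)} {f : Equiv.Perm (Fin n)} (hf : f * f = 1)
    (hs : f.support ⊆ Aᶜ) (i j : Fin n) : (prj A f).U i j ↔ i ≠ j ∧ f i = j := by
  constructor
  · rintro ⟨h1, h2, _⟩; exact ⟨h1, h2⟩
  · rintro ⟨h1, rfl⟩
    refine ⟨h1, rfl, inv_symm hf i, ?_, ?_⟩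
    · have := hs (Equiv.Perm.mem_support.2 h1.symm)
      simpa using this
    · have : f i ∈ f.support := by
        rw [Equiv.Perm.mem_support, inv_symm hf]; exact h1
      simpa using hs this

theorem tp_inj {r : ℕ} : Set.InjOn (fun p : Pat n => tp (prj p.1 p.2).D) (PS n r) := by
  rintro ⟨A, f⟩ hp ⟨B, g⟩ hq h
  obtain ⟨f1, f2, _⟩ := mem_PS hp
  obtain ⟨g1, g2, _⟩ := mem_PS hq
  simp only [tp, Prod.mk.injEq, domSet_D, dom_prj, Finset.coe_inj] at h
  obtain ⟨rfl, h⟩ := h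
  have key : ∀ i j, (i = j ∨ (i ≠ j ∧ f i = j)) ↔ (i = j ∨ (i ≠ j ∧ g i = j)) := by
    intro i j
    rw [← prj_U f1 f2, ← prj_U g1 g2]
    exact iff_of_eq (congrFun (congrFun h i) j)
  have : f = g := by
    ext i
    have h1 := key i (f i)
    have h2 := key i (g i)
    grind
  rw [this]

theorem card_X0 (r : ℕ) (h : r + 2 ≤ n) : (X0 n r).card =
    (if r = 0 then 0 else n.choose (r - 1) * oddDF (n - r)) + n.choose r * aSeq (n - r) := by
  rw [X0, Finset.card_image_of_injOn, card_PS r h]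
  intro p hp q hq h
  exact tp_inj hp hq (congrArg tp h)

theorem X0_sub (r : ℕ) : (↑(X0 n r) : Set (Dgm n)) ⊆ IPB n r := by
  intro α hα
  simp only [X0, Finset.coe_image, Set.mem_image] at hα
  obtain ⟨p, hp, rfl⟩ := hα
  refine ⟨PD.isPB _, ?_⟩
  obtain ⟨_, _, h⟩ := mem_PS hp
  rw [prank, domSet_D, dom_prj, Set.ncard_coe_finset]
  omega

theorem X0_idem (r : ℕ) : ∀ x ∈ X0 n r, pmul x x = x := by
  intro x hx
  simp only [X0, Finset.mem_image] at hx
  obtain ⟨p, _, rfl⟩ := hx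
  exact prj_idem _ _

theorem IPB_mul {r : ℕ} {a b : Dgm n} (ha : a ∈ IPB n r) (hb : b ∈ IPB n r) :
    pmul a b ∈ IPB n r :=
  ⟨isPB_pmul ha.1 hb.1,
    (Set.ncard_le_ncard (dom_pmul ha.1 hb.1) (Set.toFinite _)).trans ha.2⟩

theorem gen_sub {r : ℕ} {X : Set (Dgm n)} (hX : X ⊆ IPB n r) : genSet pmul X ⊆ IPB n r := by
  intro a ha
  induction ha with
  | base h => exact hX h
  | mul _ _ h1 h2 => exact IPB_mul h1 h2

theorem gen_mono {X Y : Set (Dgm n)} (hX : X ⊆ Y) : genSet pmul X ⊆ genSet pmul Y := by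
  intro a ha
  induction ha with
  | base h => exact MClo.base (hX h)
  | mul _ _ h1 h2 => exact MClo.mul h1 h2

theorem pe_eq_prj (d : PD n) : ∃ f : Equiv.Perm (Fin n), f * f = 1 ∧
    f.support ⊆ (d.dom.toFinset)ᶜ ∧ d.pe = prj d.dom.toFinset f ∧
    ((∀ i, i ∈ d.dom ∨ ∃ j, d.U i j) → f.support = (d.dom.toFinset)ᶜ) := by
  obtain ⟨f, hf, hU⟩ := d.exists_inv
  have hs : f.support ⊆ (d.dom.toFinset)ᶜ := by
    intro i hi
    rw [Equiv.Perm.mem_support] at hi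
    have := (hU i (f i)).2 ⟨hi.symm, rfl⟩
    simp only [Finset.mem_compl, Set.mem_toFinset]
    rintro ⟨j, hj⟩
    exact d.UT _ _ _ this hj
  refine ⟨f, hf, hs, ?_, ?_⟩
  · ext i j
    · rw [prj_U hf hs, ← hU]; rfl
    · simp [pe, prj]
    · change d.U i j ↔ (prj _ f).U i j
      rw [prj_U hf hs, ← hU]
  · intro h
    refine hs.antisymm ?_
    intro i hi
    simp only [Finset.mem_compl, Set.mem_toFinset] at hi
    obtain ⟨j, hj⟩ := (h i).resolve_left hi
    obtain ⟨h1, h2⟩ := (hU _ _).1 hj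
    rw [Equiv.Perm.mem_support, h2]
    exact h1.symm

theorem hyp_X0 {r : ℕ} (h : r + 2 ≤ n) : Hyp n r (genSet pmul ↑(X0 n r)) where
  hr := h
  mul a b ha hb := MClo.mul ha hb
  star a ha := by
    induction ha with
    | base h =>
      rename_i x
      have : pstar x = x := by
        simp only [X0, Finset.coe_image, Set.mem_image] at h
        obtain ⟨p, _, rfl⟩ := h
        rw [← star_D]
        congr 1
        ext i j
        · rfl
        · simp only [PD.star, prj]
          grind
        · rfl
      rw [this]
      exact MClo.base h
    | mul _ _ h1 h2 =>
      rw [pstar_pmul]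
      exact MClo.mul h2 h1
  h1 d hd := by
    obtain ⟨f, h1, h2, h3, _⟩ := pe_eq_prj d
    refine MClo.base ?_
    rw [h3]
    simp only [X0, Finset.coe_image]
    refine ⟨(d.dom.toFinset, f), ?_, rfl⟩
    simp only [PS, Finset.coe_union]
    right
    simp only [PS1, Finset.coe_filter, Finset.mem_univ, true_and, Set.mem_setOf_eq]
    exact ⟨by rw [← Set.ncard_eq_toFinset_card', hd], h1, h2⟩
  h2 d hd hn := by
    obtain ⟨f, h1, h2, h3, h4⟩ := pe_eq_prj d
    refine MClo.base ?_
    rw [h3]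
    simp only [X0, Finset.coe_image]
    refine ⟨(d.dom.toFinset, f), ?_, rfl⟩
    simp only [PS, Finset.coe_union]
    left
    simp only [PS2, Finset.coe_filter, Finset.mem_univ, true_and, Set.mem_setOf_eq]
    exact ⟨by rw [← Set.ncard_eq_toFinset_card', hd], h1, h4 hn⟩

theorem gen_X0 {r : ℕ} (h : r + 2 ≤ n) : genSet pmul ↑(X0 n r) = IPB n r := by
  refine (gen_sub (X0_sub r)).antisymm ?_
  rintro α ⟨hα, hr⟩
  obtain ⟨d, rfl⟩ := PD.exists_of_isPB hα
  change d.dom.ncard ≤ r at hr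
  exact (hyp_X0 h).all (r - d.dom.ncard) d (by omega)

/-! ### Lower bound -/

def NoSing (a : Dgm n) : Prop := ∀ i, i ∉ domSet a → ∃ j, j ≠ i ∧ a.r (Sum.inl i) (Sum.inl j)

theorem parity {a : Dgm n} (ha : IsPB a) (h : NoSing a) : 2 ∣ n - prank a := by
  obtain ⟨d, rfl⟩ := PD.exists_of_isPB ha
  obtain ⟨f, h1, h2, h3, h4⟩ := pe_eq_prj d
  have hs := h4 (by
    intro i
    by_cases hi : i ∈ d.dom
    · exact Or.inl hi
    · obtain ⟨j, hj, hj'⟩ := h i hi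
      exact Or.inr ⟨j, hj'.resolve_left hj.symm⟩)
  have := Equiv.Perm.two_dvd_card_support (σ := f) (by rw [sq, h1])
  rw [hs, Finset.card_compl, Fintype.card_fin, ← Set.ncard_eq_toFinset_card'] at this
  exact this

def Good (r : ℕ) (a : Dgm n) : Prop := prank a = r ∨ (prank a + 1 = r ∧ NoSing a)

theorem good_step {r : ℕ} (h : r + 2 ≤ n) {a b : Dgm n} (ha : a ∈ IPB n r) (hb : b ∈ IPB n r)
    (hg : Good r (pmul a b)) : Good r a ∧ tp a = tp (pmul a b) := by
  have hsub := dom_pmul ha.1 hb.1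
  have hle : prank (pmul a b) ≤ prank a := Set.ncard_le_ncard hsub (Set.toFinite _)
  have har := ha.2
  have hNS : NoSing (pmul a b) → NoSing a := by
    intro hN i hi
    obtain ⟨j, hj, hij⟩ := hN i (fun h => hi (hsub h))
    by_cases hs : ∀ y, a.r (Sum.inl i) y → y = Sum.inl i
    · have := pmul_upsing hs _ hij
      simp at this
      exact absurd this hj
    · push Not at hs
      obtain ⟨y, hy, hne⟩ := hs
      rcases y with k | k
      · exact ⟨k, fun h => hne (by rw [h]), hy⟩
      · exact absurd ⟨k, hy⟩ hi
  have heq : prank a = prank (pmul a b) := by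
    rcases hg with hg | ⟨hg, hN⟩
    · omega
    · have p1 := parity (isPB_pmul ha.1 hb.1) hN
      have p2 := parity ha.1 (hNS hN)
      omega
  have hdom : domSet (pmul a b) = domSet a :=
    Set.eq_of_subset_of_ncard_le hsub heq.le (Set.toFinite _)
  refine ⟨?_, ?_⟩
  · rcases hg with hg | ⟨hg, hN⟩
    · exact Or.inl (heq.trans hg)
    · exact Or.inr ⟨by omega, hNS hN⟩
  · simp only [tp, hdom]
    congr 1
    funext i j
    exact propext (up_pmul_iff ha.1 hb.1 hdom i j).symm

theorem lower {r : ℕ} (h : r + 2 ≤ n) (X : Finset (Dgm n)) (hX : genSet pmul ↑X = IPB n r) :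
    (PS n r).card ≤ X.card := by
  have key : ∀ a, MClo pmul (↑X : Set (Dgm n)) a → Good r a → ∃ x ∈ X, tp x = tp a := by
    intro a ha
    induction ha with
    | base hx => intro _; exact ⟨_, hx, rfl⟩
    | @mul u v hu hv ih1 _ =>
      intro hg
      have hu' : u ∈ IPB n r := hX ▸ hu
      have hv' : v ∈ IPB n r := hX ▸ hv
      obtain ⟨h1, h2⟩ := good_step h hu' hv' hg
      obtain ⟨x, hx, hx'⟩ := ih1 h1
      exact ⟨x, hx, hx'.trans h2⟩
  rw [← Finset.card_image_of_injOn (tp_inj (n := n) (r := r))]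
  refine le_trans (Finset.card_le_card ?_) (Finset.card_image_le (s := X) (f := tp))
  intro t ht
  rw [Finset.mem_image] at ht ⊢
  obtain ⟨p, hp, rfl⟩ := ht
  refine key _ ?_ ?_
  · have : (prj p.1 p.2).D ∈ IPB n r :=
      X0_sub r (Finset.mem_coe.2 (Finset.mem_image_of_mem (fun p : Pat n => (prj p.1 p.2).D) hp))
    rw [← hX] at this
    exact this
  · obtain ⟨h1, h2, h3⟩ := mem_PS hp
    have hr : prank (prj p.1 p.2).D = p.1.card := by
      rw [prank, domSet_D, dom_prj, Set.ncard_coe_finset]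
    rcases h3 with h3 | ⟨h3, h4⟩
    · exact Or.inl (hr.trans h3)
    · refine Or.inr ⟨by omega, ?_⟩
      intro i hi
      rw [domSet_D, dom_prj] at hi
      have : i ∈ p.2.support := by rw [h4]; simpa using hi
      rw [Equiv.Perm.mem_support] at this
      exact ⟨p.2 i, this, Or.inr ((prj_U h1 h2 _ _).2 ⟨this.symm, rfl⟩)⟩

end PBR

/-- For `0 ≤ r ≤ n - 2` the ideal `I_r(PB_n)` is
idempotent-generated, and its rank and idempotent rank both equal
`C(n, r-1)·(n-r)!! + C(n, r)·a(n-r)` (the first term, whose binomial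
coefficient has lower index `r - 1`, vanishes when `r = 0`). -/
theorem rank_IPB (n r : ℕ) (h : r + 2 ≤ n) :
    IdptGen (pmul (n := n)) (IPB n r) ∧
    rnk (pmul (n := n)) (IPB n r) =
      (if r = 0 then 0 else Nat.choose n (r - 1) * oddDF (n - r)) +
        Nat.choose n r * aSeq (n - r) ∧
    idrnk (pmul (n := n)) (IPB n r) =
      (if r = 0 then 0 else Nat.choose n (r - 1) * oddDF (n - r)) +
        Nat.choose n r * aSeq (n - r) := by
  refine ⟨?_, ?_, ?_⟩
  · refine Set.Subset.antisymm (PBR.gen_sub fun x hx => hx.1) ?_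
    conv_lhs => rw [← PBR.gen_X0 h]
    exact PBR.gen_mono fun x hx => ⟨PBR.X0_sub r hx, PBR.X0_idem r x hx⟩
  · rw [← PBR.card_PS r h]
    have hmem : (PBR.PS n r).card ∈
        {k | ∃ X : Finset (Dgm n), X.card = k ∧ genSet pmul ↑X = IPB n r} :=
      ⟨PBR.X0 n r, by rw [PBR.card_X0 r h, PBR.card_PS r h], PBR.gen_X0 h⟩
    refine le_antisymm (Nat.sInf_le hmem) (le_csInf ⟨_, hmem⟩ ?_)
    rintro k ⟨X, rfl, hX⟩
    exact PBR.lower h X hX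
  · rw [← PBR.card_PS r h]
    have hmem : (PBR.PS n r).card ∈
        {k | ∃ X : Finset (Dgm n), X.card = k ∧ (∀ x ∈ X, pmul x x = x) ∧
          genSet pmul ↑X = IPB n r} :=
      ⟨PBR.X0 n r, by rw [PBR.card_X0 r h, PBR.card_PS r h], PBR.X0_idem r, PBR.gen_X0 h⟩
    refine le_antisymm (Nat.sInf_le hmem) (le_csInf ⟨_, hmem⟩ ?_)
    rintro k ⟨X, rfl, _, hX⟩
    exact PBR.lower h X hX
end
end

section
/- For n ≥ 2, the singular ideal I_{n−1}(PB_n) = PB_n ∖ S_n is not idempotent-generated. Moreover PB_n ∖ S_n = ⟨D_{n−1}(PB_n) ∪ D_{n−2}(PB_n)⟩, and rank(PB_n ∖ S_n) = C(n+1,2) if n ≤ 3, and rank(PB_n ∖ S_n) = 1 + C(n+1,2) if n ≥ 4. -/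
/-!
Partial Brauer diagrams on `n` points are formalized as set partitions
(equivalence relations, i.e. `Setoid`s) of the vertex set
`{1,…,n} ∪ {1',…,n'}`, encoded as `Fin n ⊕ Fin n`
(`Sum.inl i` is the upper vertex `i`, `Sum.inr i` is the lower vertex `i'`),
all of whose blocks have size at most 2.  The product of two diagrams is
defined via connectivity (paths) in the product graph, and the involution `*`
by interchanging the two rows of vertices.
-/

noncomputable section

open scoped Classical

open Dgm
namespace Dgm

variable {n : ℕ}

theorem dext {α β : Dgm n} (h : ∀ x y, α.r x y ↔ β.r x y) : α = β := Setoid.ext h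

theorem drefl (α : Dgm n) (x : PBV n) : α.r x x := α.iseqv.refl x
theorem dsymm {α : Dgm n} {x y : PBV n} (h : α.r x y) : α.r y x := α.iseqv.symm h
theorem dtrans {α : Dgm n} {x y z : PBV n} (h : α.r x y) (h' : α.r y z) : α.r x z :=
  α.iseqv.trans h h'

theorem rgen_inv {V T : Type*} {r : V → V → Prop} (F : V → T)
    (h : ∀ x y, r x y → F x = F y) {x y : V} (hx : RGen r x y) : F x = F y := by
  induction hx with
  | rel h' => exact h _ _ h'
  | refl => rfl
  | symm _ ih => exact ih.symm
  | trans _ _ ih1 ih2 => exact ih1.trans ih2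

theorem pmul_inv {T : Type*} {α β : Dgm n} (F : V3 n → T)
    (hα : ∀ a b, α.r a b → F (topMid a) = F (topMid b))
    (hβ : ∀ a b, β.r a b → F (midBot a) = F (midBot b)) {x y : PBV n}
    (h : (pmul α β).r x y) : F (topBot x) = F (topBot y) := by
  refine rgen_inv F ?_ h
  rintro x y (⟨a, b, h, rfl, rfl⟩ | ⟨a, b, h, rfl, rfl⟩)
  · exact hα a b h
  · exact hβ a b h

theorem eL {α β : Dgm n} {a b : PBV n} (h : α.r a b) :
    RGen (prodEdges α β) (topMid a) (topMid b) := RGen.rel (Or.inl ⟨a, b, h, rfl, rfl⟩)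
theorem eR {α β : Dgm n} {a b : PBV n} (h : β.r a b) :
    RGen (prodEdges α β) (midBot a) (midBot b) := RGen.rel (Or.inr ⟨a, b, h, rfl, rfl⟩)

theorem mul_top {α β : Dgm n} {k l : Fin n} (h : α.r (Sum.inl k) (Sum.inl l)) :
    (pmul α β).r (Sum.inl k) (Sum.inl l) := eL (β := β) h

theorem top_class {α β : Dgm n} {k : Fin n} (hk : k ∉ domSet α) {y : PBV n}
    (h : (pmul α β).r (Sum.inl k) y) : ∃ l, y = Sum.inl l ∧ α.r (Sum.inl k) (Sum.inl l) := by
  have hk' : ∀ j, ¬ α.r (Sum.inl k) (Sum.inr j) := fun j hj => hk ⟨j, hj⟩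
  have := pmul_inv (fun v : V3 n => match v with
    | Sum.inl l => α.r (Sum.inl k) (Sum.inl l)
    | _ => False) ?_ ?_ h
  · rcases y with l | l
    · have h2 : α.r (Sum.inl k) (Sum.inl l) := by
        have h3 : α.r (Sum.inl k) (Sum.inl k) = α.r (Sum.inl k) (Sum.inl l) := this
        exact h3 ▸ drefl α _
      exact ⟨l, rfl, h2⟩
    · have h3 : α.r (Sum.inl k) (Sum.inl k) = False := this
      exact (h3 ▸ drefl α _ : False).elim
  · rintro (a | a) (b | b) hab
    · exact propext ⟨fun h => dtrans h hab, fun h => dtrans h (dsymm hab)⟩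
    · exact propext ⟨fun h => hk' _ (dtrans h hab), False.elim⟩
    · exact propext ⟨False.elim, fun h => hk' _ (dtrans h (dsymm hab))⟩
    · rfl
  · rintro (a | a) (b | b) hab <;> rfl

theorem dom_mul {α β : Dgm n} : domSet (pmul α β) ⊆ domSet α := by
  rintro k ⟨j, hj⟩
  by_contra hk
  obtain ⟨l, hl, -⟩ := top_class hk hj
  cases hl

/-! Closure of PB under products -/

theorem topMid_inj : Function.Injective (topMid (n := n)) := by
  rintro (a | a) (b | b) h <;> simp_all [topMid]
theorem midBot_inj : Function.Injective (midBot (n := n)) := by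
  rintro (a | a) (b | b) h <;> simp_all [midBot]
theorem topBot_inj : Function.Injective (topBot (n := n)) := by
  rintro (a | a) (b | b) h <;> simp_all [topBot]

/-- lifted edges: `true` for the first factor, `false` for the second. -/
def edge (α β : Dgm n) : Bool → V3 n → V3 n → Prop
  | true, x, y => ∃ a b, α.r a b ∧ x = topMid a ∧ y = topMid b
  | false, x, y => ∃ a b, β.r a b ∧ x = midBot a ∧ y = midBot b

theorem edge_symm {α β : Dgm n} {s : Bool} {x y : V3 n} (h : edge α β s x y) :
    edge α β s y x := by
  cases s <;> obtain ⟨a, b, h, rfl, rfl⟩ := h <;> exact ⟨b, a, dsymm h, rfl, rfl⟩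

theorem edge_uniq {α β : Dgm n} (hα : IsPB α) (hβ : IsPB β) {s : Bool} {x y z : V3 n}
    (h : edge α β s x y) (h' : edge α β s x z) (hy : x ≠ y) (hz : x ≠ z) : y = z := by
  cases s
  · obtain ⟨a, b, h, rfl, rfl⟩ := h
    obtain ⟨a', b', h', e, rfl⟩ := h'
    obtain rfl := midBot_inj e
    rcases hβ _ _ _ h h' with rfl | rfl | rfl <;> simp_all
  · obtain ⟨a, b, h, rfl, rfl⟩ := h
    obtain ⟨a', b', h', e, rfl⟩ := h'
    obtain rfl := topMid_inj e
    rcases hα _ _ _ h h' with rfl | rfl | rfl <;> simp_all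

/-- one step of the deterministic walk -/
def wstep (α β : Dgm n) (p q : V3 n × Bool) : Prop :=
  q.2 = !p.2 ∧ p.1 ≠ q.1 ∧ edge α β p.2 p.1 q.1

theorem wstep_uniq {α β : Dgm n} (hα : IsPB α) (hβ : IsPB β) :
    Relator.RightUnique (wstep α β) := by
  rintro ⟨x, s⟩ ⟨y, t⟩ ⟨z, u⟩ ⟨h1, h2, h3⟩ ⟨h1', h2', h3'⟩
  have := edge_uniq hα hβ h3 h3' h2 h2'
  simp_all

def tside : PBV n → Bool
  | Sum.inl _ => true
  | Sum.inr _ => false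

theorem tside_edge {α β : Dgm n} (x : PBV n) {y : V3 n}
    (h : edge α β (!tside x) (topBot x) y) : topBot x = y := by
  rcases x with x | x
  · obtain ⟨a, b, h, e, rfl⟩ := h
    rcases a with a | a <;> simp [topBot, midBot] at e
  · obtain ⟨a, b, h, e, rfl⟩ := h
    rcases a with a | a <;> simp [topBot, topMid] at e

theorem walk_closed {α β : Dgm n} (hα : IsPB α) (hβ : IsPB β) (x : PBV n) {v w : V3 n}
    {s t : Bool} (h : Relation.ReflTransGen (wstep α β) (topBot x, tside x) (v, s))
    (e : edge α β t v w) :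
    ∃ u, Relation.ReflTransGen (wstep α β) (topBot x, tside x) (w, u) := by
  by_cases hvw : v = w
  · subst hvw; exact ⟨_, h⟩
  by_cases hts : t = s
  · subst hts
    exact ⟨!t, h.tail ⟨rfl, hvw, e⟩⟩
  · have hts : t = !s := by cases t <;> cases s <;> simp_all
    subst hts
    rcases Relation.ReflTransGen.cases_tail h with h0 | ⟨⟨u, r⟩, hu, ⟨h1, h2, h3⟩⟩
    · simp only [Prod.mk.injEq] at h0
      obtain ⟨rfl, rfl⟩ := h0
      exact absurd (tside_edge x e) hvw
    · simp only at h1 h2 h3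
      subst h1
      have : u = w := edge_uniq hα hβ (edge_symm h3) (by simpa using e) (Ne.symm h2) hvw
      subst this
      exact ⟨_, hu⟩

theorem walk_of_pmul {α β : Dgm n} (hα : IsPB α) (hβ : IsPB β) {x y : PBV n}
    (h : (pmul α β).r x y) :
    ∃ u, Relation.ReflTransGen (wstep α β) (topBot x, tside x) (topBot y, u) := by
  have := rgen_inv (fun v => ∃ u, Relation.ReflTransGen (wstep α β) (topBot x, tside x) (v, u))
    ?_ h
  · exact this ▸ ⟨_, .refl⟩
  · intro v w hvw
    have : ∃ t, edge α β t v w := by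
      rcases hvw with h | h
      · exact ⟨true, h⟩
      · exact ⟨false, h⟩
    obtain ⟨t, ht⟩ := this
    exact propext ⟨fun ⟨u, hu⟩ => walk_closed hα hβ x hu ht,
      fun ⟨u, hu⟩ => walk_closed hα hβ x hu (edge_symm ht)⟩

theorem stuck {α β : Dgm n} {x y : PBV n} (hxy : x ≠ y) {u : Bool}
    (h : Relation.ReflTransGen (wstep α β) (topBot x, tside x) (topBot y, u)) :
    ∀ q, ¬ wstep α β (topBot y, u) q := by
  rintro ⟨q, b⟩ ⟨h1, h2, h3⟩
  rcases Relation.ReflTransGen.cases_tail h with h0 | ⟨⟨v, r⟩, hu, ⟨h1', h2', h3'⟩⟩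
  · simp only [Prod.mk.injEq] at h0
    exact hxy (topBot_inj h0.1.symm)
  · simp only at h1' h2' h3' h1 h2 h3
    subst h1'
    by_cases hr : r = tside y
    · subst hr
      exact h2 (tside_edge y h3)
    · have hr : r = !tside y := by cases h : tside y <;> cases r <;> simp_all
      subst hr
      exact h2' (tside_edge y (edge_symm h3')).symm

theorem pb_mul {α β : Dgm n} (hα : IsPB α) (hβ : IsPB β) : IsPB (pmul α β) := by
  intro x y z hy hz
  by_contra! hne
  obtain ⟨hxy, hxz, hyz⟩ := hne
  obtain ⟨u, hu⟩ := walk_of_pmul hα hβ hy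
  obtain ⟨v, hv⟩ := walk_of_pmul hα hβ hz
  have s1 := stuck hxy hu
  have s2 := stuck hxz hv
  rcases Relation.ReflTransGen.total_of_right_unique (wstep_uniq hα hβ) hu hv with h | h
  · rcases Relation.ReflTransGen.cases_head h with h | ⟨c, hc, -⟩
    · simp only [Prod.mk.injEq] at h
      exact hyz (topBot_inj h.1)
    · exact s1 _ hc
  · rcases Relation.ReflTransGen.cases_head h with h | ⟨c, hc, -⟩
    · simp only [Prod.mk.injEq] at h
      exact hyz (topBot_inj h.1.symm)
    · exact s2 _ hc

/-! The singular part -/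

theorem prank_eq_n {α : Dgm n} : prank α = n ↔ domSet α = Set.univ := by
  unfold prank
  constructor
  · intro h
    apply Set.eq_of_subset_of_ncard_le (Set.subset_univ _) (by simp [Set.ncard_univ, h])
  · intro h; simp [h, Set.ncard_univ]

theorem mem_T {α : Dgm n} : α ∈ PBset n \ DPB n n ↔ IsPB α ∧ ∃ i, i ∉ domSet α := by
  simp only [Set.mem_sdiff, PBset, DPB, Set.mem_ofPred_eq, prank_eq_n, not_and]
  constructor
  · rintro ⟨h, h'⟩
    refine ⟨h, ?_⟩
    by_contra! hc
    exact h' h (Set.eq_univ_of_forall hc)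
  · rintro ⟨h, i, hi⟩
    exact ⟨h, fun _ h' => hi (h' ▸ trivial)⟩

theorem T_mul {α β : Dgm n} (hα : α ∈ PBset n \ DPB n n) (hβ : β ∈ PBset n \ DPB n n) :
    pmul α β ∈ PBset n \ DPB n n := by
  rw [mem_T] at *
  obtain ⟨i, hi⟩ := hα.2
  exact ⟨pb_mul hα.1 hβ.1, i, fun h => hi (dom_mul h)⟩

theorem prank_T {α : Dgm n} {s : Finset (Fin n)} (hd : domSet α = (↑s : Set (Fin n))ᶜ) :
    prank α = n - s.card := by
  unfold prank
  rw [hd, ← Finset.coe_compl, Set.ncard_coe_finset, Finset.card_compl, Fintype.card_fin]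

@[reducible] def EE (i : Fin n) (π : Equiv.Perm (Fin n)) : Dgm n :=
  Setoid.ker (Sum.elim (fun k => if k = i then (Sum.inl i : PBV n) else Sum.inr (π k)) Sum.inr)

@[reducible] def tau (i j : Fin n) : Dgm n :=
  Setoid.ker (Sum.elim (fun k => if k = i ∨ k = j then (Sum.inl i : PBV n) else Sum.inr k)
    (fun k => if k = i ∨ k = j then (Sum.inr i : PBV n) else Sum.inr k))

variable {i j : Fin n} {π ρ : Equiv.Perm (Fin n)}

theorem EE_ll {a b : Fin n} : (EE i π).r (Sum.inl a) (Sum.inl b) ↔ a = b := by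
  change (_ = _) ↔ _
  simp only [Sum.elim_inl]
  split_ifs <;> simp_all
  exact Ne.symm ‹_›
theorem EE_lr {a b : Fin n} : (EE i π).r (Sum.inl a) (Sum.inr b) ↔ a ≠ i ∧ π a = b := by
  change (_ = _) ↔ _
  simp only [Sum.elim_inl, Sum.elim_inr]
  split_ifs <;> simp_all
theorem EE_rl {a b : Fin n} : (EE i π).r (Sum.inr b) (Sum.inl a) ↔ a ≠ i ∧ π a = b := by
  rw [← EE_lr]; exact ⟨dsymm, dsymm⟩
theorem EE_rr {a b : Fin n} : (EE i π).r (Sum.inr a) (Sum.inr b) ↔ a = b := by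
  change (_ = _) ↔ _
  simp

theorem tau_ll {a b : Fin n} : (tau i j).r (Sum.inl a) (Sum.inl b) ↔
    a = b ∨ (a = i ∧ b = j) ∨ (a = j ∧ b = i) := by
  change (_ = _) ↔ _
  simp only [Sum.elim_inl]
  split_ifs <;> grind
theorem tau_rr {a b : Fin n} : (tau i j).r (Sum.inr a) (Sum.inr b) ↔
    a = b ∨ (a = i ∧ b = j) ∨ (a = j ∧ b = i) := by
  change (_ = _) ↔ _
  simp only [Sum.elim_inr]
  split_ifs <;> grind
theorem tau_lr {a b : Fin n} : (tau i j).r (Sum.inl a) (Sum.inr b) ↔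
    a = b ∧ a ≠ i ∧ a ≠ j := by
  change (_ = _) ↔ _
  simp only [Sum.elim_inl, Sum.elim_inr]
  split_ifs <;> grind
theorem tau_rl {a b : Fin n} : (tau i j).r (Sum.inr b) (Sum.inl a) ↔
    a = b ∧ a ≠ i ∧ a ≠ j := by
  rw [← tau_lr]; exact ⟨dsymm, dsymm⟩

theorem tau_comm : tau i j = tau j i := by
  apply dext
  rintro (a | a) (b | b) <;> simp only [tau_ll, tau_lr, tau_rl, tau_rr] <;> grind

theorem EE_pb : IsPB (EE i π) := by
  rintro (a | a) (b | b) (c | c) <;> simp only [EE_ll, EE_lr, EE_rl, EE_rr] <;> grind [π.injective.eq_iff]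
theorem tau_pb : IsPB (tau i j) := by
  rintro (a | a) (b | b) (c | c) <;> simp only [tau_ll, tau_lr, tau_rl, tau_rr] <;> grind

theorem EE_dom : domSet (EE i π) = {i}ᶜ := by
  ext k
  change (∃ j, _) ↔ _
  simp only [EE_lr]
  simp
theorem tau_dom : domSet (tau i j) = {i, j}ᶜ := by
  ext k
  change (∃ j, _) ↔ _
  simp only [tau_lr]
  simp

theorem EE_D : EE i π ∈ DPB n (n - 1) :=
  ⟨EE_pb, by rw [prank_T (s := {i}) (by simp [EE_dom])]; simp⟩
theorem tau_D (h : i ≠ j) : tau i j ∈ DPB n (n - 2) :=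
  ⟨tau_pb, by rw [prank_T (s := {i, j}) (by simp [tau_dom])]; simp [Finset.card_pair h]⟩

theorem EE_T : EE i π ∈ PBset n \ DPB n n := mem_T.2 ⟨EE_pb, i, by simp [EE_dom]⟩
theorem tau_T : tau i j ∈ PBset n \ DPB n n := mem_T.2 ⟨tau_pb, i, by simp [tau_dom]⟩

theorem EE_inj (h : EE i π = EE j ρ) : i = j ∧ π = ρ := by
  have h1 : i = j := by
    have := congrArg domSet h
    rw [EE_dom, EE_dom] at this
    simpa using this
  subst h1
  refine ⟨rfl, ?_⟩
  have h2 : ∀ k, k ≠ i → π k = ρ k := by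
    intro k hk
    have : (EE i ρ).r (Sum.inl k) (Sum.inr (π k)) := h ▸ EE_lr.2 ⟨hk, rfl⟩
    exact (EE_lr.1 this).2.symm
  ext k
  by_cases hk : k = i
  · subst hk
    have : π k = ρ k := by
      by_contra hne
      have e1 : ρ (ρ.symm (π k)) = π k := by simp
      have e2 : ρ.symm (π k) ≠ k := fun h => hne (by rw [h] at e1; exact e1.symm)
      have := h2 _ e2
      rw [e1] at this
      exact e2 (π.injective this)
    rw [this]
  · rw [h2 k hk]

theorem EE_mul : pmul (EE i π) (EE (π i) ρ) = EE i (ρ * π) := by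
  apply dext
  intro x y
  constructor
  · intro h
    have := pmul_inv (fun v : V3 n => match v with
      | Sum.inl k => if k = i then (Sum.inl i : PBV n) else Sum.inr (ρ (π k))
      | Sum.inr (Sum.inl k) => if k = π i then (Sum.inl i : PBV n) else Sum.inr (ρ k)
      | Sum.inr (Sum.inr k) => Sum.inr k) ?_ ?_ h
    · rcases x with x | x <;> rcases y with y | y <;> exact this
    · rintro (a | a) (b | b) hab <;> simp only [EE_ll, EE_lr, EE_rl, EE_rr] at hab <;>
        simp only [topMid] <;> grind [π.injective.eq_iff]
    · rintro (a | a) (b | b) hab <;> simp only [EE_ll, EE_lr, EE_rl, EE_rr] at hab <;>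
        simp only [midBot] <;> grind
  · have key : ∀ a, a ≠ i → (pmul (EE i π) (EE (π i) ρ)).r (Sum.inl a) (Sum.inr (ρ (π a))) := by
      intro a ha
      have h1 : (EE i π).r (Sum.inl a) (Sum.inr (π a)) := EE_lr.2 ⟨ha, rfl⟩
      have h2 : (EE (π i) ρ).r (Sum.inl (π a)) (Sum.inr (ρ (π a))) :=
        EE_lr.2 ⟨by simpa using ha, rfl⟩
      exact RGen.trans (eL h1) (eR h2)
    rcases x with x | x <;> rcases y with y | y <;> simp only [EE_ll, EE_lr, EE_rl, EE_rr]
    · rintro rfl; exact drefl _ _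
    · rintro ⟨h, rfl⟩; exact key _ h
    · rintro ⟨h, rfl⟩; exact dsymm (key _ h)
    · rintro rfl; exact drefl _ _

/-- make all points of `S` singletons -/
@[reducible] def isol (S : Set (PBV n)) (α : Dgm n) : Dgm n where
  r x y := x = y ∨ (x ∉ S ∧ y ∉ S ∧ α.r x y)
  iseqv := ⟨fun _ => Or.inl rfl,
    by rintro x y (rfl | ⟨a, b, c⟩)
       · exact Or.inl rfl
       · exact Or.inr ⟨b, a, dsymm c⟩,
    by rintro x y z (rfl | ⟨a, b, c⟩) (rfl | ⟨a', b', c'⟩)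
       · exact Or.inl rfl
       · exact Or.inr ⟨a', b', c'⟩
       · exact Or.inr ⟨a, b, c⟩
       · exact Or.inr ⟨a, b', dtrans c c'⟩⟩

theorem isol_pb {S : Set (PBV n)} {α : Dgm n} (h : IsPB α) : IsPB (isol S α) := by
  rintro x y z (rfl | ⟨a, b, c⟩) (rfl | ⟨a', b', c'⟩)
  · simp
  · simp
  · simp
  · exact h _ _ _ c c'

/-- add an edge between singletons -/
@[reducible] def addE (α : Dgm n) (p q : PBV n) (hp : ∀ y, α.r p y → y = p)
    (hq : ∀ y, α.r q y → y = q) : Dgm n where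
  r x y := α.r x y ∨ (x = p ∧ y = q) ∨ (x = q ∧ y = p)
  iseqv := ⟨fun x => Or.inl (drefl α x),
    by rintro x y (h | h | h)
       · exact Or.inl (dsymm h)
       · exact Or.inr (Or.inr h.symm)
       · exact Or.inr (Or.inl h.symm),
    by rintro x y z (h | ⟨rfl, rfl⟩ | ⟨rfl, rfl⟩) (h' | ⟨h1, h2⟩ | ⟨h1, h2⟩)
       · exact Or.inl (dtrans h h')
       · subst h1; have := hp _ (dsymm h); subst this; exact Or.inr (Or.inl ⟨rfl, h2⟩)
       · subst h1; have := hq _ (dsymm h); subst this; exact Or.inr (Or.inr ⟨rfl, h2⟩)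
       · have := hq _ h'; subst this; simp
       · subst h1; simp [h2]
       · subst h2; exact Or.inl (drefl _ _)
       · have := hp _ h'; subst this; simp
       · subst h2; exact Or.inl (drefl _ _)
       · subst h1; simp [h2]⟩

theorem addE_pb {α : Dgm n} {p q : PBV n} {hp : ∀ y, α.r p y → y = p}
    {hq : ∀ y, α.r q y → y = q} (h : IsPB α) : IsPB (addE α p q hp hq) := by
  rintro x y z (h1 | ⟨rfl, rfl⟩ | ⟨rfl, rfl⟩) (h' | ⟨h1, h2⟩ | ⟨h1, h2⟩)
  · exact h _ _ _ h1 h'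
  · subst h2 h1; have := hp _ h1; simp [this]
  all_goals grind

theorem E_left (α : Dgm n) : pmul (EE i 1) α = isol {Sum.inl i} α := by
  apply dext
  intro x y
  constructor
  · intro h
    have := pmul_inv (fun v : V3 n => match v with
      | Sum.inl k => if k = i then none else some (Quotient.mk α (Sum.inl k))
      | Sum.inr (Sum.inl k) => some (Quotient.mk α (Sum.inl k))
      | Sum.inr (Sum.inr k) => some (Quotient.mk α (Sum.inr k))) ?_ ?_ h
    · rcases x with x | x <;> rcases y with y | y <;> simp only [topBot] at this
      · split_ifs at this with h1 h2 h2
        · exact Or.inl (by rw [h1, h2])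
        · exact Or.inr ⟨by simpa using h1, by simpa using h2, Quotient.exact (Option.some.inj this)⟩
      · split_ifs at this with h1
        · exact Or.inr ⟨by simpa using h1, by simp, Quotient.exact (Option.some.inj this)⟩
      · split_ifs at this with h1
        · exact Or.inr ⟨by simp, by simpa using h1, Quotient.exact (Option.some.inj this)⟩
      · exact Or.inr ⟨by simp, by simp, Quotient.exact (Option.some.inj this)⟩
    · rintro (a | a) (b | b) hab <;> simp only [EE_ll, EE_lr, EE_rl, EE_rr] at hab <;>
        simp only [topMid] <;> grind [Equiv.Perm.one_apply]
    · rintro (a | a) (b | b) hab <;> exact congrArg some (Quotient.sound hab)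
  · have key : ∀ x : PBV n, x ≠ Sum.inl i → RGen (prodEdges (EE i 1) α) (topBot x) (midBot x) := by
      rintro (x | x) hx
      · have h1 : (EE i 1).r (Sum.inl x) (Sum.inr x) := EE_lr.2 ⟨by simpa using hx, rfl⟩
        exact eL h1
      · exact RGen.refl _
    rintro (rfl | ⟨h1, h2, h3⟩)
    · exact drefl _ _
    · exact ((key x h1).trans (eR h3)).trans (key y h2).symm

theorem tau_left {α : Dgm n} (hij : i ≠ j) (hp : ∀ y, α.r (Sum.inl i) y → y = Sum.inl i)
    (hq : ∀ y, α.r (Sum.inl j) y → y = Sum.inl j) :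
    pmul (tau i j) α = addE α (Sum.inl i) (Sum.inl j) hp hq := by
  apply dext
  intro x y
  constructor
  · intro h
    have := pmul_inv (fun v : V3 n => match v with
      | Sum.inl k => if k = i ∨ k = j then none else some (Quotient.mk α (Sum.inl k))
      | Sum.inr (Sum.inl k) => if k = i ∨ k = j then none else some (Quotient.mk α (Sum.inl k))
      | Sum.inr (Sum.inr k) => some (Quotient.mk α (Sum.inr k))) ?_ ?_ h
    · rcases x with x | x <;> rcases y with y | y <;> simp only [topBot] at this
      · split_ifs at this with h1 h2 h2
        · rcases h1 with rfl | rfl <;> rcases h2 with rfl | rfl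
          · exact drefl _ _
          · exact Or.inr (Or.inl ⟨rfl, rfl⟩)
          · exact Or.inr (Or.inr ⟨rfl, rfl⟩)
          · exact drefl _ _
        · exact Or.inl (Quotient.exact (Option.some.inj this))
      · split_ifs at this with h1
        · exact Or.inl (Quotient.exact (Option.some.inj this))
      · split_ifs at this with h1
        · exact Or.inl (Quotient.exact (Option.some.inj this))
      · exact Or.inl (Quotient.exact (Option.some.inj this))
    · rintro (a | a) (b | b) hab <;> simp only [tau_ll, tau_lr, tau_rl, tau_rr] at hab <;>
        simp only [topMid] <;> grind
    · have sd : ∀ a b, α.r a b → some (Quotient.mk α a) = some (Quotient.mk α b) :=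
        fun a b h => congrArg some (Quotient.sound h)
      have sy : ∀ a b, α.r a b → α.r b a := fun a b h => dsymm h
      rintro (a | a) (b | b) hab <;> simp only [midBot] <;> grind
  · have key : ∀ x : PBV n, x ≠ Sum.inl i → x ≠ Sum.inl j →
        RGen (prodEdges (tau i j) α) (topBot x) (midBot x) := by
      rintro (x | x) hx hx'
      · have h1 : (tau i j).r (Sum.inl x) (Sum.inr x) :=
          tau_lr.2 ⟨rfl, by simpa using hx, by simpa using hx'⟩
        exact eL h1
      · exact RGen.refl _
    have hk : (pmul (tau i j) α).r (Sum.inl i) (Sum.inl j) :=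
      mul_top (tau_ll.2 (Or.inr (Or.inl ⟨rfl, rfl⟩)))
    rintro (h | ⟨rfl, rfl⟩ | ⟨rfl, rfl⟩)
    · by_cases hxy : x = y
      · subst hxy; exact drefl _ _
      · have h1 : x ≠ Sum.inl i := by rintro rfl; exact hxy (hp _ h).symm
        have h2 : x ≠ Sum.inl j := by rintro rfl; exact hxy (hq _ h).symm
        have h3 : y ≠ Sum.inl i := by rintro rfl; exact hxy (hp _ (dsymm h))
        have h4 : y ≠ Sum.inl j := by rintro rfl; exact hxy (hq _ (dsymm h))
        exact ((key x h1 h2).trans (eR h)).trans (key y h3 h4).symm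
    · exact hk
    · exact dsymm hk

theorem tau_right {α : Dgm n} (hij : i ≠ j) (hp : ∀ y, α.r (Sum.inr i) y → y = Sum.inr i)
    (hq : ∀ y, α.r (Sum.inr j) y → y = Sum.inr j) :
    pmul α (tau i j) = addE α (Sum.inr i) (Sum.inr j) hp hq := by
  apply dext
  intro x y
  constructor
  · intro h
    have := pmul_inv (fun v : V3 n => match v with
      | Sum.inl k => some (Quotient.mk α (Sum.inl k))
      | Sum.inr (Sum.inl k) => if k = i ∨ k = j then none else some (Quotient.mk α (Sum.inr k))
      | Sum.inr (Sum.inr k) => if k = i ∨ k = j then none else some (Quotient.mk α (Sum.inr k)))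
        ?_ ?_ h
    · rcases x with x | x <;> rcases y with y | y <;> simp only [topBot] at this
      · exact Or.inl (Quotient.exact (Option.some.inj this))
      · split_ifs at this with h1
        · exact Or.inl (Quotient.exact (Option.some.inj this))
      · split_ifs at this with h1
        · exact Or.inl (Quotient.exact (Option.some.inj this))
      · split_ifs at this with h1 h2 h2
        · rcases h1 with rfl | rfl <;> rcases h2 with rfl | rfl
          · exact drefl _ _
          · exact Or.inr (Or.inl ⟨rfl, rfl⟩)
          · exact Or.inr (Or.inr ⟨rfl, rfl⟩)
          · exact drefl _ _
        · exact Or.inl (Quotient.exact (Option.some.inj this))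
    · have sd : ∀ a b, α.r a b → some (Quotient.mk α a) = some (Quotient.mk α b) :=
        fun a b h => congrArg some (Quotient.sound h)
      have sy : ∀ a b, α.r a b → α.r b a := fun a b h => dsymm h
      rintro (a | a) (b | b) hab <;> simp only [topMid] <;> grind
    · rintro (a | a) (b | b) hab <;> simp only [tau_ll, tau_lr, tau_rl, tau_rr] at hab <;>
        simp only [midBot] <;> grind
  · have key : ∀ x : PBV n, x ≠ Sum.inr i → x ≠ Sum.inr j →
        RGen (prodEdges α (tau i j)) (topBot x) (topMid x) := by
      rintro (x | x) hx hx'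
      · exact RGen.refl _
      · have h1 : (tau i j).r (Sum.inr x) (Sum.inl x) :=
          tau_rl.2 ⟨rfl, by simpa using hx, by simpa using hx'⟩
        exact eR h1
    have hk : (pmul α (tau i j)).r (Sum.inr i) (Sum.inr j) :=
      eR (tau_rr.2 (Or.inr (Or.inl ⟨rfl, rfl⟩)) : (tau i j).r (Sum.inr i) (Sum.inr j))
    rintro (h | ⟨rfl, rfl⟩ | ⟨rfl, rfl⟩)
    · by_cases hxy : x = y
      · subst hxy; exact drefl _ _
      · have h1 : x ≠ Sum.inr i := by rintro rfl; exact hxy (hp _ h).symm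
        have h2 : x ≠ Sum.inr j := by rintro rfl; exact hxy (hq _ h).symm
        have h3 : y ≠ Sum.inr i := by rintro rfl; exact hxy (hp _ (dsymm h))
        have h4 : y ≠ Sum.inr j := by rintro rfl; exact hxy (hq _ (dsymm h))
        exact ((key x h1 h2).trans (eL h)).trans (key y h3 h4).symm
    · exact hk
    · exact dsymm hk

theorem char_EE {α : Dgm n} (hα : IsPB α) (hi : i ∉ domSet α)
    (hk : ∀ k, k ≠ i → k ∈ domSet α) : ∃ π, α = EE i π := by
  have hk' : ∀ k, ∃ l, k ≠ i → α.r (Sum.inl k) (Sum.inr l) := by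
    intro k
    by_cases h : k = i
    · exact ⟨k, fun h' => absurd h h'⟩
    · obtain ⟨l, hl⟩ := hk k h
      exact ⟨l, fun _ => hl⟩
  choose f hf using hk'
  have hinj : Set.InjOn f {k | k ≠ i} := by
    intro a ha b hb hab
    have h1 := dsymm (hf a ha)
    have h2 := dsymm (hf b hb)
    rw [← hab] at h2
    rcases hα _ _ _ h1 h2 with h | h | h
    · cases h
    · cases h
    · exact Sum.inl.inj h
  obtain ⟨g, hg⟩ := Set.MapsTo.exists_equiv_extend_of_card_eq (t := Finset.univ) (by simp)
    (s := {k | k ≠ i}) (f := f) (fun _ _ => by simp) hinj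
  let π : Equiv.Perm (Fin n) := Equiv.ofBijective (fun k => (g k : Fin n))
    (Finite.injective_iff_bijective.1 (fun a b h => g.injective (Subtype.ext h)))
  have hπ : ∀ k, k ≠ i → α.r (Sum.inl k) (Sum.inr (π k)) := by
    intro k hk
    have : π k = f k := hg k hk
    rw [this]; exact hf k hk
  have full : ∀ k, k ≠ i → ∀ y, α.r (Sum.inl k) y → y = Sum.inl k ∨ y = Sum.inr (π k) := by
    intro k hk y hy
    rcases hα _ _ _ (hπ k hk) hy with h | h | h
    · cases h
    · exact Or.inl h.symm
    · exact Or.inr h.symm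
  have si : ∀ y, α.r (Sum.inl i) y → y = Sum.inl i := by
    rintro (y | y) hy
    · by_contra hne
      have hne : y ≠ i := fun h => hne (by rw [h])
      rcases full y hne _ (dsymm hy) with h | h
      · exact hne (Sum.inl.inj h).symm
      · cases h
    · exact absurd ⟨y, hy⟩ hi
  have rr : ∀ a b, α.r (Sum.inr a) (Sum.inr b) → a = b := by
    have : ∀ k l, k ≠ i → α.r (Sum.inr (π k)) (Sum.inr (π l)) → k = l := by
      intro k l hk h
      rcases full k hk _ (dtrans (hπ k hk) h) with h | h
      · cases h
      · exact (π.injective (Sum.inr.inj h)).symm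
    intro a b h
    obtain ⟨k, rfl⟩ := π.surjective a
    obtain ⟨l, rfl⟩ := π.surjective b
    by_cases h1 : k = i
    · by_cases h2 : l = i
      · rw [h1, h2]
      · rw [this l k h2 (dsymm h)]
    · rw [this k l h1 h]
  have lr : ∀ a b, α.r (Sum.inl a) (Sum.inr b) ↔ a ≠ i ∧ π a = b := by
    intro a b
    constructor
    · intro h
      have ha : a ≠ i := by rintro rfl; exact hi ⟨b, h⟩
      refine ⟨ha, ?_⟩
      rcases full a ha _ h with h | h
      · cases h
      · exact (Sum.inr.inj h).symm
    · rintro ⟨h, rfl⟩; exact hπ a h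
  refine ⟨π, dext ?_⟩
  rintro (a | a) (b | b)
  · rw [EE_ll]
    constructor
    · intro h
      by_cases ha : a = i
      · subst ha; exact (Sum.inl.inj (si _ h)).symm
      · rcases full a ha _ h with h | h
        · exact (Sum.inl.inj h).symm
        · cases h
    · rintro rfl; exact drefl _ _
  · rw [EE_lr]; exact lr a b
  · rw [EE_rl, ← lr]; exact ⟨dsymm, dsymm⟩
  · rw [EE_rr]
    constructor
    · exact rr a b
    · rintro rfl; exact drefl _ _

theorem exists_codom {α : Dgm n} (hα : IsPB α) (hi : i ∉ domSet α) :
    ∃ j, ∀ k, ¬ α.r (Sum.inr j) (Sum.inl k) := by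
  by_contra! hc
  choose f hf using hc
  have hinj : Function.Injective f := by
    intro a b hab
    have h1 := dsymm (hf a)
    have h2 := dsymm (hf b)
    rw [← hab] at h2
    rcases hα _ _ _ h1 h2 with h | h | h
    · cases h
    · cases h
    · exact Sum.inr.inj h
  obtain ⟨a, rfl⟩ := Finite.surjective_of_injective hinj i
  exact hi ⟨a, dsymm (hf a)⟩

theorem gen_hookfree {X : Set (Dgm n)} (hE : ∀ i π, MClo pmul X (EE i π)) :
    ∀ m : ℕ, ∀ α : Dgm n, ((domSet α)ᶜ).ncard = m → IsPB α → (∃ i, i ∉ domSet α) →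
      (∀ a b, α.r (Sum.inl a) (Sum.inl b) → a = b) →
      (∀ a b, α.r (Sum.inr a) (Sum.inr b) → a = b) → MClo pmul X α := by
  intro m
  induction m using Nat.strong_induction_on with
  | _ m ih =>
  rintro α hm hα ⟨i, hi⟩ hl hr
  by_cases hk : ∀ k, k ≠ i → k ∈ domSet α
  · obtain ⟨π, rfl⟩ := char_EE hα hi hk
    exact hE i π
  push Not at hk
  obtain ⟨k, hki, hk⟩ := hk
  obtain ⟨j, hj⟩ := exists_codom hα hi
  have hp : ∀ y, α.r (Sum.inl i) y → y = Sum.inl i := by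
    rintro (y | y) hy
    · rw [hl _ _ hy]
    · exact absurd ⟨y, hy⟩ hi
  have hq : ∀ y, α.r (Sum.inr j) y → y = Sum.inr j := by
    rintro (y | y) hy
    · exact absurd hy (hj y)
    · rw [hr _ _ hy]
  have e : pmul (EE i 1) (addE α _ _ hp hq) = α := by
    rw [E_left]
    apply dext
    intro x y
    constructor
    · rintro (rfl | ⟨h1, h2, h | ⟨h, -⟩ | ⟨-, h⟩⟩)
      · exact drefl _ _
      · exact h
      · exact absurd h h1
      · exact absurd h h2
    · intro h
      by_cases hxy : x = y
      · exact Or.inl hxy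
      · refine Or.inr ⟨?_, ?_, Or.inl h⟩
        · rintro rfl; exact hxy (hp _ h).symm
        · rintro rfl; exact hxy (hp _ (dsymm h))
  rw [← e]
  refine MClo.mul (hE i 1) (ih _ ?_ _ rfl (addE_pb hα) ⟨k, ?_⟩ ?_ ?_)
  · rw [← hm]
    apply Set.ncard_lt_ncard _ (Set.toFinite _)
    constructor
    · intro a ha ⟨b, hb⟩
      exact ha ⟨b, Or.inl hb⟩
    · intro h
      exact h hi ⟨j, Or.inr (Or.inl ⟨rfl, rfl⟩)⟩
  · rintro ⟨b, h | ⟨h, -⟩ | ⟨h, -⟩⟩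
    · exact hk ⟨b, h⟩
    · exact hki (Sum.inl.inj h)
    · cases h
  · rintro a b (h | ⟨-, h⟩ | ⟨h, -⟩)
    · exact hl _ _ h
    · cases h
    · cases h
  · rintro a b (h | ⟨h, -⟩ | ⟨-, h⟩)
    · exact hr _ _ h
    · cases h
    · cases h

theorem addE_isol {α : Dgm n} (hα : IsPB α) {p q : PBV n} (hpq : p ≠ q) (h : α.r p q)
    (hp : ∀ y, (isol {p, q} α).r p y → y = p) (hq : ∀ y, (isol {p, q} α).r q y → y = q) :
    addE (isol {p, q} α) p q hp hq = α := by
  apply dext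
  intro x y
  constructor
  · rintro ((rfl | ⟨_, _, h⟩) | ⟨rfl, rfl⟩ | ⟨rfl, rfl⟩)
    · exact drefl _ _
    · assumption
    · assumption
    · exact dsymm h
  · intro hxy
    by_cases e : x = y
    · exact Or.inl (Or.inl e)
    · by_cases h1 : x = p
      · subst h1
        rcases hα _ _ _ h hxy with h | h | h
        · exact absurd h hpq
        · exact absurd h e
        · exact Or.inr (Or.inl ⟨rfl, h.symm⟩)
      by_cases h2 : x = q
      · subst h2
        rcases hα _ _ _ (dsymm h) hxy with h | h | h
        · exact absurd h.symm hpq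
        · exact absurd h e
        · exact Or.inr (Or.inr ⟨rfl, h.symm⟩)
      refine Or.inl (Or.inr ⟨by simp [h1, h2], ?_, hxy⟩)
      rintro (rfl | h3)
      · rcases hα _ _ _ h (dsymm hxy) with h | h | h
        · exact hpq h
        · exact h1 h.symm
        · exact h2 h.symm
      · obtain rfl := h3
        rcases hα _ _ _ (dsymm h) (dsymm hxy) with h | h | h
        · exact hpq h.symm
        · exact h2 h.symm
        · exact h1 h.symm

theorem isol_p {α : Dgm n} {S : Set (PBV n)} {p : PBV n} (hp : p ∈ S) :
    ∀ y, (isol S α).r p y → y = p := by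
  rintro y (rfl | ⟨h, -⟩)
  · rfl
  · exact absurd hp h

theorem isol_lt {α : Dgm n} {p q : PBV n} (hpq : p ≠ q) (h : α.r p q) :
    {z : PBV n × PBV n | (isol {p, q} α).r z.1 z.2}.ncard <
      {z : PBV n × PBV n | α.r z.1 z.2}.ncard := by
  apply Set.ncard_lt_ncard _ (Set.toFinite _)
  constructor
  · rintro ⟨x, y⟩ (h | ⟨_, _, h⟩)
    · simp only at h; subst h; exact drefl _ _
    · exact h
  · intro hh
    have : (p, q) ∈ {z : PBV n × PBV n | (isol {p, q} α).r z.1 z.2} := hh h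
    rcases this with h | ⟨h, -⟩
    · exact hpq h
    · simp at h

theorem isol_dom {α : Dgm n} {S : Set (PBV n)} : domSet (isol S α) ⊆ domSet α := by
  rintro k ⟨j, h | ⟨_, _, h⟩⟩
  · cases h
  · exact ⟨j, h⟩

theorem gen_all {X : Set (Dgm n)} (hE : ∀ i π, MClo pmul X (EE i π))
    (ht : ∀ i j, i ≠ j → MClo pmul X (tau i j)) :
    ∀ m : ℕ, ∀ α : Dgm n, {z : PBV n × PBV n | α.r z.1 z.2}.ncard = m → IsPB α →
      (∃ i, i ∉ domSet α) → MClo pmul X α := by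
  intro m
  induction m using Nat.strong_induction_on with
  | _ m ih =>
  rintro α hm hα ⟨i, hi⟩
  by_cases hl : ∀ a b, α.r (Sum.inl a) (Sum.inl b) → a = b
  · by_cases hr : ∀ a b, α.r (Sum.inr a) (Sum.inr b) → a = b
    · exact gen_hookfree hE _ α rfl hα ⟨i, hi⟩ hl hr
    · push Not at hr
      obtain ⟨a, b, hab, hne⟩ := hr
      have hne' : (Sum.inr a : PBV n) ≠ Sum.inr b := by simpa using hne
      rw [← addE_isol hα hne' hab (isol_p (by simp)) (isol_p (by simp)), ← tau_right hne]
      exact MClo.mul (ih _ (hm ▸ isol_lt hne' hab) _ rfl (isol_pb hα)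
        ⟨i, fun h => hi (isol_dom h)⟩) (ht a b hne)
  · push Not at hl
    obtain ⟨a, b, hab, hne⟩ := hl
    have hne' : (Sum.inl a : PBV n) ≠ Sum.inl b := by simpa using hne
    rw [← addE_isol hα hne' hab (isol_p (by simp)) (isol_p (by simp)), ← tau_left hne]
    exact MClo.mul (ht a b hne) (ih _ (hm ▸ isol_lt hne' hab) _ rfl (isol_pb hα)
        ⟨i, fun h => hi (isol_dom h)⟩)

theorem gen_eq {X : Set (Dgm n)} (hX : X ⊆ PBset n \ DPB n n) (hE : ∀ i π, MClo pmul X (EE i π))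
    (ht : ∀ i j, i ≠ j → MClo pmul X (tau i j)) : genSet pmul X = PBset n \ DPB n n := by
  ext α
  constructor
  · intro h
    change MClo pmul X α at h
    induction h with
    | base h => exact hX h
    | mul _ _ h1 h2 => exact T_mul h1 h2
  · intro h
    rw [mem_T] at h
    exact gen_all hE ht _ α rfl h.1 h.2

/-! Lower bound -/

/-- the defect of α is the pair / point `{i,j}` -/
def Pij (i j : Fin n) (α : Dgm n) : Prop :=
  α.r (Sum.inl i) (Sum.inl j) ∧ i ∉ domSet α ∧ j ∉ domSet α ∧ ∀ k, k ≠ i → k ≠ j → k ∈ domSet α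

theorem Pij_left {α β : Dgm n} (hα : α ∈ PBset n \ DPB n n)
    (h : Pij i j (pmul α β)) : Pij i j α := by
  obtain ⟨h1, h2, h3, h4⟩ := h
  obtain ⟨hp, m, hm⟩ := mem_T.1 hα
  have h4' : ∀ k, k ≠ i → k ≠ j → k ∈ domSet α := fun k a b => dom_mul (h4 k a b)
  have main : ∀ i j : Fin n, (pmul α β).r (Sum.inl i) (Sum.inl j) → i ∉ domSet α →
      α.r (Sum.inl i) (Sum.inl j) ∧ j ∉ domSet α := by
    intro i j h hi
    obtain ⟨l, hl, h'⟩ := top_class hi h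
    obtain rfl := Sum.inl.inj hl
    exact ⟨h', fun ⟨k, hk⟩ => hi ⟨k, dtrans h' hk⟩⟩
  have hm' : m = i ∨ m = j := by
    by_contra! hc
    exact hm (h4' m hc.1 hc.2)
  rcases hm' with rfl | rfl
  · obtain ⟨a, b⟩ := main _ _ h1 hm
    exact ⟨a, hm, b, h4'⟩
  · obtain ⟨a, b⟩ := main _ _ (dsymm h1) hm
    exact ⟨dsymm a, b, hm, h4'⟩

theorem MClo_T {X : Set (Dgm n)} (hX : X ⊆ PBset n \ DPB n n) {α : Dgm n}
    (h : MClo pmul X α) : α ∈ PBset n \ DPB n n := by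
  induction h with
  | base h => exact hX h
  | mul _ _ h1 h2 => exact T_mul h1 h2

theorem Pij_gen {X : Set (Dgm n)} (hX : X ⊆ PBset n \ DPB n n) {α : Dgm n}
    (h : MClo pmul X α) (hP : Pij i j α) : ∃ x ∈ X, Pij i j x := by
  induction h with
  | base h => exact ⟨_, h, hP⟩
  | mul h1 h2 ih1 ih2 => exact ih1 (Pij_left (MClo_T hX h1) hP)

theorem Pij_uniq {a b : Fin n} {α : Dgm n} (h : Pij i j α) (h' : Pij a b α) :
    s(i, j) = s(a, b) := by
  obtain ⟨-, h2, h3, h4⟩ := h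
  obtain ⟨-, h2', h3', h4'⟩ := h'
  have : ∀ k, (k = i ∨ k = j) ↔ (k = a ∨ k = b) := by
    intro k
    constructor
    · rintro (rfl | rfl)
      · by_contra! hc; exact h2 (h4' _ hc.1 hc.2)
      · by_contra! hc; exact h3 (h4' _ hc.1 hc.2)
    · rintro (rfl | rfl)
      · by_contra! hc; exact h2' (h4 _ hc.1 hc.2)
      · by_contra! hc; exact h3' (h4 _ hc.1 hc.2)
  ext k
  simpa using this k

theorem EE_P : Pij i i (EE i π) :=
  ⟨drefl _ _, by simp [EE_dom], by simp [EE_dom], fun k hk _ => by simpa [EE_dom] using hk⟩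
theorem tau_P : Pij i j (tau i j) :=
  ⟨tau_ll.2 (by simp), by simp [tau_dom], by simp [tau_dom],
    fun k hk hk' => by simp [tau_dom, hk, hk']⟩

theorem char_P {α : Dgm n} (hα : IsPB α) (h : Pij i i α) : ∃ π, α = EE i π :=
  char_EE hα h.2.1 (fun k hk => h.2.2.2 k hk hk)

theorem E_prod {γ : Dgm n} (hγ : γ ∈ PBset n \ DPB n n) (h : Pij i i (pmul (EE i π) γ)) :
    ∃ ρ, γ = EE (π i) ρ := by
  have key : ∀ k, k ≠ i → π k ∈ domSet γ := by
    intro k hk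
    by_contra hc
    obtain ⟨l, hl⟩ := h.2.2.2 k hk hk
    have dd : ∀ a b, γ.r (Sum.inl a) (Sum.inl b) → (a ∈ domSet γ ↔ b ∈ domSet γ) :=
      fun a b hab => ⟨fun ⟨c, hc⟩ => ⟨c, dtrans (dsymm hab) hc⟩, fun ⟨c, hc⟩ => ⟨c, dtrans hab hc⟩⟩
    have dl : ∀ a b, γ.r (Sum.inl a) (Sum.inr b) → a ∈ domSet γ := fun a b hab => ⟨b, hab⟩
    have := pmul_inv (fun v : V3 n => match v with
      | Sum.inl k => k ≠ i ∧ π k ∉ domSet γ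
      | Sum.inr (Sum.inl k) => k ∉ domSet γ
      | Sum.inr (Sum.inr k) => False) ?_ ?_ hl
    · have e : (k ≠ i ∧ π k ∉ domSet γ) = False := this
      exact e ▸ ⟨hk, hc⟩
    · rintro (a | a) (b | b) hab <;> simp only [EE_ll, EE_lr, EE_rl, EE_rr] at hab <;>
        simp only [topMid] <;> grind
    · rintro (a | a) (b | b) hab <;> simp only [midBot]
      · rw [dd _ _ hab]
      · exact eq_false (fun h => h (dl _ _ hab))
      · exact (eq_false (fun h => h (dl _ _ (dsymm hab)))).symm
  obtain ⟨hp, m, hm⟩ := mem_T.1 hγ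
  have : m = π i := by
    obtain ⟨k, rfl⟩ := π.surjective m
    by_contra hc
    exact hm (key k (fun h => hc (by rw [h])))
  subst this
  refine char_EE hp hm ?_
  intro k hk
  obtain ⟨k, rfl⟩ := π.surjective k
  exact key k (fun h => hk (by rw [h]))

/-- induction principle for rank `n-1` elements -/
theorem EE_ind {X : Set (Dgm n)} (hX : X ⊆ PBset n \ DPB n n)
    (Q : Fin n → Equiv.Perm (Fin n) → Prop)
    (hb : ∀ i π, EE i π ∈ X → Q i π)
    (hm : ∀ i π ρ, Q i π → Q (π i) ρ → Q i (ρ * π)) {α : Dgm n} (h : MClo pmul X α) :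
    ∀ i π, α = EE i π → Q i π := by
  induction h with
  | base h => rintro i π rfl; exact hb i π h
  | @mul x y h1 h2 ih1 ih2 =>
    intro i π e
    have hP : Pij i i (pmul x y) := e ▸ EE_P
    obtain ⟨σ, rfl⟩ := char_P (mem_T.1 (MClo_T hX h1)).1 (Pij_left (MClo_T hX h1) hP)
    obtain ⟨ρ, rfl⟩ := E_prod (MClo_T hX h2) hP
    rw [EE_mul] at e
    rw [← (EE_inj e).2]
    exact hm _ _ _ (ih1 _ _ rfl) (ih2 _ _ rfl)

theorem not_idpt (h : 2 ≤ n) : ¬ IdptGen (pmul (n := n)) (PBset n \ DPB n n) := by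
  intro hI
  unfold IdptGen at hI
  have h1 : EE (⟨0, by omega⟩ : Fin n) (Equiv.swap ⟨0, by omega⟩ ⟨1, by omega⟩) ∈
      PBset n \ DPB n n := EE_T
  rw [← hI] at h1
  have := EE_ind (X := {x ∈ PBset n \ DPB n n | pmul x x = x}) (fun x hx => hx.1)
    (fun i π => π = 1) ?_ ?_ h1 _ _ rfl
  · have := congrArg (fun π => π (⟨0, by omega⟩ : Fin n)) this
    simp at this
  · rintro i π ⟨hT, hi⟩
    have hP : Pij i i (pmul (EE i π) (EE i π)) := by rw [hi]; exact EE_P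
    obtain ⟨ρ, hρ⟩ := E_prod hT hP
    have := EE_inj hρ
    have e : pmul (EE i π) (EE (π i) π) = EE i π := by rw [← this.1]; exact hi
    rw [EE_mul] at e
    simpa using (EE_inj e).2
  · rintro i π ρ rfl rfl
    rfl

/-- words -/
def WW (f : Fin n → Equiv.Perm (Fin n)) (i : Fin n) : ℕ → Equiv.Perm (Fin n)
  | 0 => 1
  | k + 1 => f (WW f i k i) * WW f i k

theorem WW_add (f : Fin n → Equiv.Perm (Fin n)) (i : Fin n) (k l : ℕ) :
    WW f i (k + l) = WW f (WW f i k i) l * WW f i k := by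
  induction l with
  | zero => simp [WW]
  | succ l ih =>
    rw [← add_assoc]
    simp only [WW]
    rw [ih]
    simp [mul_assoc]

theorem lower1 {X : Finset (Dgm n)} (hX : genSet pmul (X : Set (Dgm n)) = PBset n \ DPB n n) :
    ∃ F : Sym2 (Fin n) → X, Function.Injective F ∧
      ∀ s, ∃ i j, s = s(i, j) ∧ Pij i j (F s).1 := by
  have hXT : (X : Set (Dgm n)) ⊆ PBset n \ DPB n n := by
    rw [← hX]; exact fun x hx => MClo.base hx
  have : ∀ s : Sym2 (Fin n), ∃ x : X, ∃ i j, s = s(i, j) ∧ Pij i j x.1 := by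
    intro s
    induction s with
    | _ i j =>
    have h1 : tau i j ∈ genSet pmul (X : Set (Dgm n)) := hX ▸ tau_T
    obtain ⟨x, hx, hP⟩ := Pij_gen hXT h1 tau_P
    exact ⟨⟨x, hx⟩, i, j, rfl, hP⟩
  choose F hF using this
  refine ⟨F, ?_, hF⟩
  intro s t hst
  obtain ⟨i, j, rfl, h1⟩ := hF s
  obtain ⟨a, b, rfl, h2⟩ := hF t
  rw [hst] at h1
  exact Pij_uniq h1 h2

theorem lower_card {X : Finset (Dgm n)}
    (hX : genSet pmul (X : Set (Dgm n)) = PBset n \ DPB n n) :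
    (if n ≤ 3 then 0 else 1) + Nat.choose (n + 1) 2 ≤ X.card := by
  have hXT : (X : Set (Dgm n)) ⊆ PBset n \ DPB n n := by
    rw [← hX]; exact fun x hx => MClo.base hx
  obtain ⟨F, hF, hP⟩ := lower1 hX
  have hc := Fintype.card_le_of_injective F hF
  rw [Sym2.card, Fintype.card_fin, Fintype.card_coe] at hc
  split_ifs with hn
  · omega
  by_contra hlt
  have hcard : Fintype.card (Sym2 (Fin n)) = Fintype.card X := by
    rw [Sym2.card, Fintype.card_fin, Fintype.card_coe]; omega
  have hbij := (Fintype.bijective_iff_injective_and_card F).2 ⟨hF, hcard⟩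
  have uniq : ∀ i, ∀ x ∈ X, Pij i i x → x = F s(i, i) := by
    intro i x hx hPx
    obtain ⟨s, hs⟩ := hbij.2 ⟨x, hx⟩
    obtain ⟨a, b, rfl, hab⟩ := hP s
    rw [hs] at hab
    rw [Pij_uniq hPx hab, hs]
  have hf : ∀ i, ∃ π, (F s(i, i)).1 = EE i π := by
    intro i
    obtain ⟨a, b, hs, hab⟩ := hP s(i, i)
    have : a = i ∧ b = i := by
      have := hs.symm
      rcases Sym2.eq_iff.1 this with h | h
      · exact h
      · exact h
    rw [this.1, this.2] at hab
    exact char_P (mem_T.1 (hXT (F s(i, i)).2)).1 hab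
  choose f hf using hf
  have key : ∀ i π, ∃ k, π = WW f i k := by
    intro i π
    have h1 : EE i π ∈ genSet pmul (X : Set (Dgm n)) := hX ▸ EE_T
    refine EE_ind hXT (fun i π => ∃ k, π = WW f i k) ?_ ?_ h1 i π rfl
    · intro i π h
      refine ⟨1, ?_⟩
      have := uniq i _ h EE_P
      rw [hf] at this
      simpa [WW] using (EE_inj this).2
    · rintro i π ρ ⟨k, rfl⟩ ⟨l, rfl⟩
      exact ⟨k + l, (WW_add f i k l).symm⟩
  let p0 : Fin n := ⟨0, by omega⟩
  let p1 : Fin n := ⟨1, by omega⟩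
  let p2 : Fin n := ⟨2, by omega⟩
  let p3 : Fin n := ⟨3, by omega⟩
  have e01 : p0 ≠ p1 := by simp [p0, p1]
  have e02 : p0 ≠ p2 := by simp [p0, p2]
  have e03 : p0 ≠ p3 := by simp [p0, p3]
  have e12 : p1 ≠ p2 := by simp [p1, p2]
  have e13 : p1 ≠ p3 := by simp [p1, p3]
  have e23 : p2 ≠ p3 := by simp [p2, p3]
  obtain ⟨k, hk⟩ := key p0 (Equiv.swap p1 p2)
  obtain ⟨l, hl⟩ := key p0 (Equiv.swap p2 p3)
  have c1 := WW_add f p0 k l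
  have c2 := WW_add f p0 l k
  rw [← hk, Equiv.swap_apply_of_ne_of_ne e01 e02, ← hl] at c1
  rw [← hl, Equiv.swap_apply_of_ne_of_ne e02 e03, ← hk, add_comm, c1] at c2
  have := congrArg (fun π => π p1) c2
  simp only [Equiv.Perm.mul_apply] at this
  rw [Equiv.swap_apply_left, Equiv.swap_apply_left, Equiv.swap_apply_of_ne_of_ne e12 e13,
    Equiv.swap_apply_left] at this
  exact e23 this.symm

/-! Upper bound -/

def phi {m : ℕ} (e : Equiv.Perm (Fin m)) : Equiv.Perm (Fin (m + 1)) :=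
  Equiv.Perm.decomposeFin.symm (0, e)

theorem phi_zero {m : ℕ} (e : Equiv.Perm (Fin m)) : phi e 0 = 0 := by
  simp [phi]
theorem phi_succ {m : ℕ} (e : Equiv.Perm (Fin m)) (x : Fin m) : phi e x.succ = (e x).succ := by
  simp [phi]
theorem phi_mul {m : ℕ} (e f : Equiv.Perm (Fin m)) : phi (e * f) = phi e * phi f := by
  apply Equiv.ext
  intro x
  refine Fin.cases ?_ (fun x => ?_) x
  · simp [phi_zero]
  · simp [phi_succ]
theorem phi_one {m : ℕ} : phi (1 : Equiv.Perm (Fin m)) = 1 := by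
  apply Equiv.ext
  intro x
  refine Fin.cases ?_ (fun x => ?_) x
  · simp [phi_zero]
  · simp [phi_succ]
theorem phi_surj {m : ℕ} (π : Equiv.Perm (Fin (m + 1))) (h : π 0 = 0) : ∃ e, π = phi e := by
  obtain ⟨⟨p, e⟩, rfl⟩ := Equiv.Perm.decomposeFin.symm.surjective π
  refine ⟨e, ?_⟩
  rw [Equiv.Perm.decomposeFin_symm_apply_zero] at h
  rw [h]; rfl

def GG {m : ℕ} (i : Fin (m + 1)) : Equiv.Perm (Fin (m + 1)) :=
  if i = Fin.last m then phi (finRotate m) * finRotate (m + 1) else finRotate (m + 1)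

theorem cpow {m : ℕ} (k : ℕ) (i : Fin (m + 1)) :
    ((finRotate (m + 1) ^ k) i).val = (i.val + k) % (m + 1) := by
  induction k with
  | zero => simp [Nat.mod_eq_of_lt i.2]
  | succ k ih =>
    rw [pow_succ', Equiv.Perm.mul_apply, finRotate_apply, Fin.val_add, ih, Fin.val_one']
    rw [← Nat.add_mod, add_assoc]

theorem cpow_val {m : ℕ} (k : ℕ) (i : Fin (m + 1)) (h : i.val + k ≤ m) :
    ((finRotate (m + 1) ^ k) i).val = i.val + k := by
  rw [cpow, Nat.mod_eq_of_lt (by omega)]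

theorem cpow_full {m : ℕ} : finRotate (m + 1) ^ (m + 1) = 1 := by
  apply Equiv.ext
  intro i
  apply Fin.ext
  rw [cpow]
  simp [Nat.mod_eq_of_lt i.2]

theorem grpd {m : ℕ} (x : Fin m) (Q : Fin (m + 1) → Equiv.Perm (Fin (m + 1)) → Prop)
    (hg : ∀ i, Q i (GG i)) (hx : 3 ≤ m → Q 0 (phi (Equiv.swap x (finRotate m x))))
    (hm : ∀ i π ρ, Q i π → Q (π i) ρ → Q i (ρ * π)) : ∀ i π, Q i π := by
  have hm0 : 0 < m := x.pos
  have hA : ∀ (i : Fin (m + 1)) k, i.val + k + 1 ≤ m → Q i (finRotate (m + 1) ^ (k + 1)) := by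
    intro i k
    induction k with
    | zero =>
      intro h
      have := hg i
      rw [GG, if_neg (by intro h'; rw [h'] at h; simp at h)] at this
      simpa using this
    | succ k ih =>
      intro h
      have h1 := ih (by omega)
      have h2 := hg ((finRotate (m + 1) ^ (k + 1)) i)
      have h3 := cpow_val (k + 1) i (by omega)
      rw [GG, if_neg (by intro h'; rw [h'] at h3; simp at h3; omega)] at h2
      rw [pow_succ']
      exact hm _ _ _ h1 h2
  have hB : ∀ i : Fin (m + 1),
      Q i (phi (finRotate m) * finRotate (m + 1) ^ (m + 1 - i.val)) := by
    intro i
    by_cases hi : i = Fin.last m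
    · subst hi
      have := hg (Fin.last m)
      rw [GG, if_pos rfl] at this
      simpa using this
    · have hlt : i.val < m := by
        have := i.2
        have : i.val ≠ m := fun h => hi (Fin.ext h)
        omega
      have h1 := hA i (m - 1 - i.val) (by omega)
      have e : (finRotate (m + 1) ^ (m - 1 - i.val + 1)) i = Fin.last m := by
        apply Fin.ext
        rw [cpow_val _ _ (by omega), Fin.val_last]
        omega
      have h2 := hg (Fin.last m)
      rw [GG, if_pos rfl, ← e] at h2
      have := hm _ _ _ h1 h2
      rw [mul_assoc, ← pow_succ'] at this
      have e2 : m - 1 - i.val + 1 + 1 = m + 1 - i.val := by omega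
      rwa [e2] at this
  have ha : Q 0 (phi (finRotate m)) := by
    have := hB 0
    simpa [cpow_full] using this
  have hmul : ∀ e f, Q 0 (phi e) → Q 0 (phi f) → Q 0 (phi (e * f)) := by
    intro e f he hf
    rw [phi_mul]
    exact hm _ _ _ hf (by rw [phi_zero]; exact he)
  have hpow : ∀ k, Q 0 (phi (finRotate m ^ (k + 1))) := by
    intro k
    induction k with
    | zero => simpa using ha
    | succ k ih => rw [pow_succ]; exact hmul _ _ ih ha
  have h1 : Q 0 (phi 1) := by
    have := hpow (orderOf (finRotate m) - 1)
    rwa [Nat.sub_add_cancel (orderOf_pos _), pow_orderOf_eq_one] at this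
  let H : Submonoid (Equiv.Perm (Fin m)) :=
    { carrier := {e | Q 0 (phi e)}, mul_mem' := fun {a b} => hmul a b, one_mem' := h1 }
  have hH : ∀ e, Q 0 (phi e) := by
    rcases Nat.lt_or_ge m 2 with h2 | h2
    · have : m = 1 := by omega
      subst this
      intro e
      rw [Subsingleton.elim e 1]; exact h1
    · have hs : Q 0 (phi (Equiv.swap x (finRotate m x))) := by
        rcases Nat.lt_or_ge m 3 with h3 | h3
        · have : m = 2 := by omega
          subst this
          have : Equiv.swap x (finRotate 2 x) = finRotate 2 := by
            clear hx; revert x; decide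
          rw [this]; exact ha
        · exact hx h3
      have htop := Equiv.Perm.closure_cycle_adjacent_swap (isCycle_finRotate_of_le h2)
        (support_finRotate_of_le h2) x
      have h4 : Submonoid.closure {finRotate m, Equiv.swap x (finRotate m x)} ≤ H := by
        rw [Submonoid.closure_le]
        rintro e (rfl | rfl)
        · exact ha
        · exact hs
      intro e
      apply h4
      rw [← Subgroup.closure_toSubmonoid_of_finite, htop]
      trivial
  intro i π
  have hu : Q 0 (finRotate (m + 1) ^ (π i).val) := by
    by_cases h : (π i).val = 0
    · rw [h, pow_zero, ← phi_one]; exact h1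
    · have := hA 0 ((π i).val - 1) (by have := (π i).2; simp; omega)
      rwa [Nat.sub_add_cancel (by omega)] at this
  have hu0 : (finRotate (m + 1) ^ (π i).val) 0 = π i := by
    apply Fin.ext
    rw [cpow_val _ _ (by have := (π i).2; simp; omega)]
    simp
  have hv0 : (phi (finRotate m) * finRotate (m + 1) ^ (m + 1 - i.val)) i = 0 := by
    rw [Equiv.Perm.mul_apply]
    have : (finRotate (m + 1) ^ (m + 1 - i.val)) i = 0 := by
      apply (finRotate (m + 1) ^ i.val).injective
      rw [← Equiv.Perm.mul_apply, ← pow_add, Nat.add_sub_cancel' i.2.le, cpow_full]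
      apply Fin.ext
      rw [cpow_val _ _ (by have := i.2; simp; omega)]
      simp
    rw [this, phi_zero]
  generalize finRotate (m + 1) ^ (π i).val = u at hu hu0
  have hv := hB i
  generalize phi (finRotate m) * finRotate (m + 1) ^ (m + 1 - i.val) = v at hv hv0
  obtain ⟨l, hl⟩ := phi_surj (u⁻¹ * π * v⁻¹) (by
    have : v⁻¹ 0 = i := by rw [← hv0]; simp
    rw [Equiv.Perm.mul_apply, Equiv.Perm.mul_apply, this, ← hu0]; simp)
  have e : π = u * (phi l * v) := by rw [← hl]; group
  rw [e]
  apply hm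
  · exact hm _ _ _ hv (by rw [hv0]; exact hH l)
  · rw [Equiv.Perm.mul_apply, hv0, phi_zero]; exact hu

theorem MClo_mono {γ : Type*} {m : γ → γ → γ} {X Y : Set γ} (h : X ⊆ Y) {x : γ}
    (hx : MClo m X x) : MClo m Y x := by
  induction hx with
  | base h' => exact MClo.base (h h')
  | mul _ _ h1 h2 => exact MClo.mul h1 h2

def gens {m : ℕ} (s : Sym2 (Fin (m + 1))) : Dgm (m + 1) :=
  Sym2.lift ⟨fun i j => if i = j then EE i (GG i) else tau i j, by
    intro i j
    by_cases h : i = j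
    · subst h; rfl
    · simp only [if_neg h, if_neg (Ne.symm h)]; exact tau_comm⟩ s

theorem upper {m : ℕ} (x : Fin m) : ∃ X : Finset (Dgm (m + 1)),
    X.card ≤ (if m + 1 ≤ 3 then 0 else 1) + Nat.choose (m + 1 + 1) 2 ∧
    genSet pmul (X : Set (Dgm (m + 1))) = PBset (m + 1) \ DPB (m + 1) (m + 1) := by
  let Y : Finset (Dgm (m + 1)) := if m + 1 ≤ 3 then ∅ else
    {EE 0 (phi (Equiv.swap x (finRotate m x)))}
  let Z : Finset (Dgm (m + 1)) := Finset.univ.image gens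
  have hdiag : ∀ i, EE i (GG i) ∈ Z := by
    intro i
    exact Finset.mem_image.2 ⟨s(i, i), Finset.mem_univ _, by simp [gens]⟩
  refine ⟨Y ∪ Z, ?_, gen_eq ?_ ?_ ?_⟩
  · refine (Finset.card_union_le _ _).trans (Nat.add_le_add ?_ ?_)
    · dsimp only [Y]
      split_ifs <;> simp
    · refine Finset.card_image_le.trans ?_
      rw [Finset.card_univ, Sym2.card, Fintype.card_fin]
  · intro a ha
    rcases Finset.mem_union.1 (Finset.mem_coe.1 ha) with h | h
    · dsimp only [Y] at h
      split_ifs at h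
      · simp at h
      · rw [Finset.mem_singleton.1 h]; exact EE_T
    · obtain ⟨s, -, rfl⟩ := Finset.mem_image.1 h
      induction s with
      | _ i j =>
      simp only [gens, Sym2.lift_mk]
      split_ifs
      · exact EE_T
      · exact tau_T
  · refine grpd x (fun i π => MClo pmul _ (EE i π)) ?_ ?_ ?_
    · intro i
      exact MClo.base (Finset.mem_coe.2 (Finset.mem_union_right _ (hdiag i)))
    · intro h
      refine MClo.base (Finset.mem_coe.2 (Finset.mem_union_left _ ?_))
      dsimp only [Y]
      rw [if_neg (by omega)]
      simp
    · intro i π ρ h1 h2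
      rw [← EE_mul]
      exact MClo.mul h1 h2
  · intro i j hij
    refine MClo.base (Finset.mem_coe.2 (Finset.mem_union_right _ ?_))
    exact Finset.mem_image.2 ⟨s(i, j), Finset.mem_univ _, by simp [gens, hij]⟩

theorem gen_top2 (h : 2 ≤ n) :
    PBset n \ DPB n n = genSet (pmul (n := n)) (DPB n (n - 1) ∪ DPB n (n - 2)) := by
  symm
  refine gen_eq ?_ (fun i π => MClo.base (Or.inl EE_D)) (fun i j hij => MClo.base (Or.inr (tau_D hij)))
  rintro α (⟨h1, h2⟩ | ⟨h1, h2⟩)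
  · exact ⟨h1, fun h' => by have := h'.2; omega⟩
  · exact ⟨h1, fun h' => by have := h'.2; omega⟩

theorem rank_final (h : 2 ≤ n) : rnk (pmul (n := n)) (PBset n \ DPB n n) =
      (if n ≤ 3 then 0 else 1) + Nat.choose (n + 1) 2 := by
  obtain ⟨m, rfl⟩ : ∃ m, n = m + 1 := ⟨n - 1, by omega⟩
  obtain ⟨X, hc, hX⟩ := upper (⟨0, by omega⟩ : Fin m)
  unfold rnk
  apply le_antisymm
  · exact le_trans (Nat.sInf_le (m := X.card) ⟨X, rfl, hX⟩) hc
  · obtain ⟨Y, hY, hY'⟩ := Nat.sInf_mem (s := {k | ∃ X : Finset (Dgm (m + 1)), X.card = k ∧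
      genSet pmul (X : Set (Dgm (m + 1))) = PBset (m + 1) \ DPB (m + 1) (m + 1)}) ⟨_, X, rfl, hX⟩
    rw [← hY]
    exact lower_card hY'

end Dgm

/-- For `n ≥ 2`, the singular ideal `PB_n ∖ S_n`
(where `S_n = D_n(PB_n)` is the group of units) is not idempotent-generated;
it is generated by its top two D-classes, and its rank is `C(n+1,2)` for
`n ≤ 3` and `1 + C(n+1,2)` for `n ≥ 4`. -/
theorem singular_ideal_PB (n : ℕ) (h : 2 ≤ n) :
    ¬ IdptGen (pmul (n := n)) (PBset n \ DPB n n) ∧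
    PBset n \ DPB n n = genSet (pmul (n := n)) (DPB n (n - 1) ∪ DPB n (n - 2)) ∧
    rnk (pmul (n := n)) (PBset n \ DPB n n) =
      (if n ≤ 3 then 0 else 1) + Nat.choose (n + 1) 2 := by
  exact ⟨not_idpt h, gen_top2 h, rank_final h⟩
end
end
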